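/- Let μ, ν be real and k an integer with k ≠ 1. Let τ ∈ ℂ with Re τ > 0, q := e^{−2πτ}, q̂ := e^{−2π/τ}. Then ζ(k,−μ) + 𝒮_k(0,−μ;ν,0;q) + (−1)^{k−1}·𝒮_k(0,μ;−ν,0;q) − (−2π)^k·Σ_{j=0}^{k+1} ((−i)^j·A_j(e(μ))·A_{k+1−j}(e(ν))/(j!(k+1−j)!))·τ^{k−j} = (−iτ)^{k−1}·( ζ(k,ν) + 𝒮_k(0,ν;μ,0;q̂) + (−1)^{k−1}·𝒮_k(0,−ν;−μ,0;q̂) ), the j-sum being empty when k+1 < 0. -/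

import Mathlib

noncomputable section

open Complex MeasureTheory
open scoped Real Classical

/-- `e(s) = exp(2 π i s)`. -/
def ee (s : ℂ) : ℂ := Complex.exp (2 * (Real.pi : ℂ) * Complex.I * s)

/-- `δ(x) = 1` if `x ∈ ℤ`, `0` otherwise. -/
def dInt (x : ℝ) : ℂ := if ∃ n : ℤ, (n : ℝ) = x then 1 else 0

/-- The Lerch zeta function `ψ(r,γ,κ) = Σ_{k ∈ ℤ, γ+k>0} e((γ+k)κ) (γ+k)^{-r}`
(a convergent series when `Re r > 1`). -/
def psiL (r : ℂ) (γ κ : ℝ) : ℂ :=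
  ∑' k : {k : ℤ // 0 < γ + (k : ℝ)},
    ee ((((γ + (k.1 : ℝ)) * κ : ℝ)) : ℂ) * (((γ + (k.1 : ℝ)) : ℝ) : ℂ) ^ (-r)

/-- The `q`-series `𝒮_r(γ,δ;κ,λ;q)`, where `q = e^{-2πt}` with `Re t > 0`, and the power
`q^{(γ+k)(δ+l)}` is interpreted as `exp (-2πt(γ+k)(δ+l))`. -/
def Scal (r : ℂ) (γ δ' κ lam : ℝ) (t : ℂ) : ℂ :=
  ∑' (k : {k : ℤ // 0 < γ + (k : ℝ)}) (l : {l : ℤ // 0 < δ' + (l : ℝ)}),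
    ee ((((γ + (k.1 : ℝ)) * κ + (δ' + (l.1 : ℝ)) * lam : ℝ)) : ℂ) *
      (((δ' + (l.1 : ℝ)) : ℝ) : ℂ) ^ (-r) *
      Complex.exp (-2 * (Real.pi : ℂ) * t * ((γ + (k.1 : ℝ) : ℝ) : ℂ) * ((δ' + (l.1 : ℝ) : ℝ) : ℂ))

/-- The generalized Eisenstein series `F_{ℤ²}(s;α,β;μ,ν;z)` (mean of the two branch
conventions), defined by an absolutely convergent series for `Re s > 2`. -/
def Fz2 (s : ℂ) (α β μ ν : ℝ) (z : ℂ) : ℂ :=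
  (∑' p : {p : ℤ × ℤ // β + (p.2 : ℝ) ≠ 0},
      ee ((((α + (p.1.1 : ℝ)) * μ + (β + (p.1.2 : ℝ)) * ν : ℝ)) : ℂ) *
        ((((α + (p.1.1 : ℝ)) : ℝ) : ℂ) + (((β + (p.1.2 : ℝ)) : ℝ) : ℂ) * z) ^ (-s)) +
  dInt β *
    ((∑' m : {m : ℤ // 0 < α + (m : ℝ)},
        ee ((((α + (m.1 : ℝ)) * μ : ℝ)) : ℂ) * (((α + (m.1 : ℝ)) : ℝ) : ℂ) ^ (-s)) +
      Complex.cos ((Real.pi : ℂ) * s) *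
        ∑' m : {m : ℤ // α + (m : ℝ) < 0},
          ee ((((α + (m.1 : ℝ)) * μ : ℝ)) : ℂ) * ((|α + (m.1 : ℝ)| : ℝ) : ℂ) ^ (-s))

/-- `𝒜(s,α,μ) = cos(πs) ψ(s,-α,-μ) + ψ(s,α,μ)`. -/
def Acal (s : ℂ) (α μ : ℝ) : ℂ :=
  Complex.cos ((Real.pi : ℂ) * s) * psiL s (-α) (-μ) + psiL s α μ

/-- `ψ(k,γ,κ)` at an integer `k`: the convergent series for `k ≥ 2`, the value
`-𝒞_{1-k}(⟨γ⟩,κ)/(1-k) - δ_{k0} δ(γ)` of the analytic continuation for `k ≤ 0`,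
and the (irrelevant) value `0` for `k = 1`; here `C` is the family of Taylor
coefficients `𝒞`. -/
def psiIntC (C : ℕ → ℂ → ℝ → ℂ) (k : ℤ) (γ κ : ℝ) : ℂ :=
  if 2 ≤ k then
    ∑' n : {n : ℤ // 0 < γ + (n : ℝ)},
      ee ((((γ + (n.1 : ℝ)) * κ : ℝ)) : ℂ) * (((γ + (n.1 : ℝ)) : ℝ) : ℂ) ^ (-k)
  else if k ≤ 0 then
    -C (1 - k).toNat ((Int.fract γ : ℝ) : ℂ) κ / ((1 : ℂ) - (k : ℂ)) -
      (if k = 0 then dInt γ else 0)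
  else 0

/-- The Bernoulli polynomial `B_j(x)` evaluated in `ℂ`. -/
def BpolyC (j : ℕ) (x : ℂ) : ℂ := Polynomial.aeval x (Polynomial.bernoulli j)

/-- Weierstrass `℘`-function with periods `(1, z)`. -/
def wpFn (z w : ℂ) : ℂ :=
  w ^ (-2 : ℤ) + ∑' p : {p : ℤ × ℤ // p ≠ (0, 0)},
    ((w - (p.1.1 : ℂ) - (p.1.2 : ℂ) * z) ^ (-2 : ℤ) -
      ((p.1.1 : ℂ) + (p.1.2 : ℂ) * z) ^ (-2 : ℤ))

/-- Weierstrass zeta function with periods `(1, z)`. -/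
def wzetaFn (z w : ℂ) : ℂ :=
  1 / w + ∑' p : {p : ℤ × ℤ // p ≠ (0, 0)},
    (1 / (w - (p.1.1 : ℂ) - (p.1.2 : ℂ) * z) + 1 / ((p.1.1 : ℂ) + (p.1.2 : ℂ) * z) +
      w / ((p.1.1 : ℂ) + (p.1.2 : ℂ) * z) ^ 2)

/-- Weierstrass sigma function with periods `(1, z)`. -/
def wsigmaFn (z w : ℂ) : ℂ :=
  w * ∏' p : {p : ℤ × ℤ // p ≠ (0, 0)},
    ((1 - w / ((p.1.1 : ℂ) + (p.1.2 : ℂ) * z)) *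
      Complex.exp (w / ((p.1.1 : ℂ) + (p.1.2 : ℂ) * z) +
        w ^ 2 / (2 * ((p.1.1 : ℂ) + (p.1.2 : ℂ) * z) ^ 2)))

/-- The `q`-Pochhammer symbol `(Z;q)_∞`. -/
def qPoch (Z q : ℂ) : ℂ := ∏' l : ℕ, (1 - Z * q ^ l)

/-- `⟨x⟩' = 1 - ⟨-x⟩`. -/
def fracP (x : ℝ) : ℝ := 1 - Int.fract (-x)

/-- The Eisenstein series `E₂`. -/
def E2cl (z : ℂ) : ℂ := 1 - 24 * ∑' l : ℕ+, (l : ℂ) * ee z ^ (l : ℕ) / (1 - ee z ^ (l : ℕ))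

/-- `a_{2k}`: `ζ(1-2k)` for `k ≠ 0` and `2ζ'(0) = -log 2π` for `k = 0`. -/
def acoef (k : ℤ) : ℂ :=
  if k = 0 then -(Real.log (2 * Real.pi) : ℂ) else riemannZeta ((1 - 2 * k : ℤ) : ℂ)

/-- The classical Eisenstein series `E_{2k}`. -/
def Ecl (k : ℤ) (z : ℂ) : ℂ :=
  1 + (2 / acoef k) * ∑' l : ℕ+, (l : ℂ) ^ (2 * k - 1) * ee z ^ (l : ℕ) / (1 - ee z ^ (l : ℕ))

/-- The bilateral Lerch zeta function `ψ_ℤ^ε(r,γ,κ) = e^{-επir} ψ(r,-γ,-κ) + ψ(r,γ,κ)`. -/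
def psiZpm (ε : ℤ) (r : ℂ) (γ κ : ℝ) : ℂ :=
  Complex.exp (-(ε : ℂ) * (Real.pi : ℂ) * Complex.I * r) * psiL r (-γ) (-κ) + psiL r γ κ

open Filter Topology Metric in
/-- Cauchy's theorem on a disc in the presence of finitely many removable singularities. -/
theorem circleIntegral_eq_zero_of_removable {f : ℂ → ℂ} {R : ℝ} (hR : 0 < R) (P : Finset ℂ)
    (hP : ∀ p ∈ P, p ∈ ball (0 : ℂ) R)
    (hd : ∀ z ∈ closedBall (0 : ℂ) R, z ∉ P → DifferentiableAt ℂ f z)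
    (hr : ∀ p ∈ P, Tendsto (fun z => (z - p) * f z) (𝓝[≠] p) (𝓝 0)) :
    (∮ z in C(0, R), f z) = 0 := by
  have hPc : IsClosed (P : Set ℂ) := P.finite_toSet.isClosed
  have hev : ∀ p : ℂ, ∀ᶠ z in 𝓝[≠] p, z ∉ P := fun p => by
    have h : IsClosed ((P.erase p : Finset ℂ) : Set ℂ) := (P.erase p).finite_toSet.isClosed
    have h1 : ∀ᶠ z in 𝓝[≠] p, z ∉ ((P.erase p : Finset ℂ) : Set ℂ) :=
      nhdsWithin_le_nhds (h.isOpen_compl.mem_nhds (by simp))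
    filter_upwards [h1, self_mem_nhdsWithin] with z hz hz' hzP
    exact hz (Finset.mem_coe.2 (Finset.mem_erase.2 ⟨hz', hzP⟩))
  have hlim : ∀ p ∈ P, Tendsto f (𝓝[≠] p) (𝓝 (limUnder (𝓝[≠] p) f)) := by
    intro p hp
    apply Complex.tendsto_limUnder_of_differentiable_on_punctured_nhds_of_isLittleO
    · filter_upwards [hev p, nhdsWithin_le_nhds (isOpen_ball.mem_nhds (hP p hp))] with z h1 h2
      exact hd z (ball_subset_closedBall h2) h1
    · have h0 : Tendsto (fun z => (z - p) * (f z - f p)) (𝓝[≠] p) (𝓝 0) := by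
        have h1 : Tendsto (fun z => (z - p) * f p) (𝓝[≠] p) (𝓝 0) := by
          have : ContinuousAt (fun z => (z - p) * f p) p := by fun_prop
          simpa using this.tendsto.mono_left nhdsWithin_le_nhds
        simpa [mul_sub] using (hr p hp).sub h1
      rw [Asymptotics.isLittleO_iff_tendsto']
      · refine h0.congr fun z => ?_
        rw [div_inv_eq_mul, mul_comm]
      · filter_upwards [self_mem_nhdsWithin] with z hz h
        exact absurd (sub_eq_zero.1 (inv_eq_zero.1 h)) hz
  set g : ℂ → ℂ := fun z => if z ∈ P then limUnder (𝓝[≠] z) f else f z with hg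
  have hgf : ∀ z, z ∉ P → g =ᶠ[𝓝 z] f := fun z hz => by
    filter_upwards [hPc.isOpen_compl.mem_nhds hz] with y hy
    simp only [hg]; rw [if_neg (fun h => hy (Finset.mem_coe.2 h))]
  have hcont : ContinuousOn g (closedBall 0 R) := by
    intro z hz
    apply ContinuousAt.continuousWithinAt
    by_cases hzP : z ∈ P
    · rw [continuousAt_iff_punctured_nhds]
      have : g z = limUnder (𝓝[≠] z) f := by simp only [hg]; rw [if_pos hzP]
      rw [this]
      refine (hlim z hzP).congr' ?_
      filter_upwards [hev z] with y hy
      simp only [hg]; rw [if_neg hy]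
    · exact ((hd z hz hzP).congr_of_eventuallyEq (hgf z hzP)).continuousAt
  have hz := circleIntegral_eq_zero_of_differentiable_on_off_countable hR.le
    (P.countable_toSet) hcont fun z hz =>
      (hd z (ball_subset_closedBall hz.1) hz.2).congr_of_eventuallyEq (hgf z hz.2)
  refine Eq.trans ?_ hz
  apply circleIntegral.integral_congr hR.le
  intro z hz
  have : z ∉ P := fun h => by
    have h1 := hP z h
    simp at hz h1
    linarith
  simp only [hg]; rw [if_neg this]

open Filter Topology Metric in
/-- The residue theorem on a disc centred at a pole of order at most `M`, the other poles being
simple. -/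
theorem circleIntegral_eq_sum_residues {f : ℂ → ℂ} {R : ℝ} (hR : 0 < R) (P : Finset ℂ)
    (hP : ∀ p ∈ P, p ∈ ball (0 : ℂ) R) (hP0 : (0 : ℂ) ∉ P)
    (hd : ∀ z ∈ closedBall (0 : ℂ) R, z ≠ 0 → z ∉ P → DifferentiableAt ℂ f z)
    (r : ℂ → ℂ) (hr : ∀ p ∈ P, Tendsto (fun z => (z - p) * f z) (𝓝[≠] p) (𝓝 (r p)))
    (M : ℕ) (hM : 1 ≤ M) (d : ℕ → ℂ)
    (h0 : Tendsto (fun z => z * (f z - ∑ n ∈ Finset.range M, d n * z ^ ((n : ℤ) - M)))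
      (𝓝[≠] 0) (𝓝 0)) :
    (∮ z in C(0, R), f z) = 2 * π * I * (∑ p ∈ P, r p + d (M - 1)) := by
  set S : ℂ → ℂ := fun z => ∑ p ∈ P, r p * (z - p)⁻¹ with hS
  set T : ℂ → ℂ := fun z => ∑ n ∈ Finset.range M, d n * z ^ ((n : ℤ) - M) with hT
  have hSd : ∀ z, z ∉ P → DifferentiableAt ℂ S z := fun z hz => by
    refine DifferentiableAt.fun_sum fun p hp => ?_
    have : z - p ≠ 0 := sub_ne_zero.2 fun h => hz (h ▸ hp)
    exact (((differentiableAt_id.sub_const p).inv this)).const_mul _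
  have hTd : ∀ z, z ≠ 0 → DifferentiableAt ℂ T z := fun z hz => by
    refine DifferentiableAt.fun_sum fun n _ => ?_
    exact (differentiableAt_zpow.2 (Or.inl hz)).const_mul _
  have hmain : (∮ z in C(0, R), (f z - S z - T z)) = 0 := by
    apply circleIntegral_eq_zero_of_removable hR (insert 0 P)
    · intro p hp
      rcases Finset.mem_insert.1 hp with rfl | hp
      · simpa using hR
      · exact hP p hp
    · intro z hz hzP
      simp only [Finset.mem_insert, not_or] at hzP
      exact ((hd z hz hzP.1 hzP.2).sub (hSd z hzP.2)).sub (hTd z hzP.1)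
    · intro p hp
      rcases Finset.mem_insert.1 hp with rfl | hp
      · have h1 : Tendsto (fun z => z * S z) (𝓝[≠] 0) (𝓝 0) := by
          have : ContinuousAt (fun z => z * S z) 0 := continuousAt_id.mul (hSd 0 hP0).continuousAt
          simpa using this.tendsto.mono_left nhdsWithin_le_nhds
        have := h0.sub h1
        simp only [sub_zero] at this ⊢
        refine this.congr fun z => ?_
        simp only [hT]; ring
      · have hp0 : p ≠ 0 := fun h => hP0 (h ▸ hp)
        have h1 : Tendsto (fun z => (z - p) * T z) (𝓝[≠] p) (𝓝 0) := by
          have : ContinuousAt (fun z => (z - p) * T z) p :=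
            (by fun_prop : ContinuousAt (fun z => z - p) p).mul (hTd p hp0).continuousAt
          simpa using this.tendsto.mono_left nhdsWithin_le_nhds
        have h2 : Tendsto (fun z => (z - p) * S z) (𝓝[≠] p) (𝓝 (r p)) := by
          have hc : ContinuousAt (fun z => (z - p) * ∑ q ∈ P.erase p, r q * (z - q)⁻¹) p := by
            refine (by fun_prop : ContinuousAt (fun z => z - p) p).mul ?_
            refine tendsto_finsetSum _ fun q hq => ?_
            refine (ContinuousAt.inv₀ (by fun_prop) ?_).const_mul _ |>.tendsto
            exact sub_ne_zero.2 (Finset.ne_of_mem_erase hq).symm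
          have h3 : Tendsto (fun z => r p + (z - p) * ∑ q ∈ P.erase p, r q * (z - q)⁻¹)
              (𝓝[≠] p) (𝓝 (r p)) := by
            have := (hc.tendsto.mono_left nhdsWithin_le_nhds : Tendsto _ (𝓝[≠] p) _).const_add (r p)
            simpa using this
          refine h3.congr' ?_
          filter_upwards [self_mem_nhdsWithin] with z hz
          have hz' : z - p ≠ 0 := sub_ne_zero.2 hz
          simp only [hS]
          rw [← Finset.add_sum_erase P _ hp, mul_add]
          congr 1
          field_simp
        have := ((hr p hp).sub h2).sub h1
        simp only [sub_self] at this
        refine this.congr fun z => ?_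
        ring
  have hsph : ∀ z ∈ sphere (0 : ℂ) R, z ≠ 0 ∧ z ∉ P := fun z hz => by
    constructor
    · rintro rfl; simp at hz; linarith
    · intro h; have := hP z h; simp at this hz; linarith
  have hcS : CircleIntegrable S 0 R := ContinuousOn.circleIntegrable hR.le
    fun z hz => (hSd z (hsph z hz).2).continuousAt.continuousWithinAt
  have hcT : CircleIntegrable T 0 R := ContinuousOn.circleIntegrable hR.le
    fun z hz => (hTd z (hsph z hz).1).continuousAt.continuousWithinAt
  have hcf : CircleIntegrable f 0 R := ContinuousOn.circleIntegrable hR.le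
    fun z hz => (hd z (sphere_subset_closedBall hz) (hsph z hz).1
      (hsph z hz).2).continuousAt.continuousWithinAt
  have hiS : (∮ z in C(0, R), S z) = 2 * π * I * ∑ p ∈ P, r p := by
    simp only [hS]
    rw [circleIntegral.integral_fun_sum]
    · rw [Finset.mul_sum]
      refine Finset.sum_congr rfl fun p hp => ?_
      rw [circleIntegral.integral_const_mul, circleIntegral.integral_sub_inv_of_mem_ball (hP p hp)]
      ring
    · intro p hp
      refine ContinuousOn.circleIntegrable hR.le fun z hz => ContinuousAt.continuousWithinAt ?_
      have : z - p ≠ 0 := sub_ne_zero.2 fun h => (hsph z hz).2 (h ▸ hp)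
      have hc : ContinuousAt (fun y : ℂ => y - p) z := by fun_prop
      exact (hc.inv₀ this).const_mul _
  have hiT : (∮ z in C(0, R), T z) = 2 * π * I * d (M - 1) := by
    simp only [hT]
    rw [circleIntegral.integral_fun_sum]
    · rw [Finset.sum_eq_single (M - 1)]
      · rw [circleIntegral.integral_const_mul]
        have : (((M - 1 : ℕ) : ℤ) - M) = -1 := by omega
        rw [this]
        have h2 := circleIntegral.integral_sub_inv_of_mem_ball (c := 0) (w := 0) (R := R)
          (by simpa using hR)
        simp only [sub_zero] at h2
        simp only [zpow_neg_one, h2]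
        ring
      · intro n _ hn
        rw [circleIntegral.integral_const_mul]
        have h2 := circleIntegral.integral_sub_zpow_of_ne (n := (n : ℤ) - M) (by omega) 0 0 R
        simp only [sub_zero] at h2
        rw [h2, mul_zero]
      · intro h; exact absurd (Finset.mem_range.2 (by omega)) h
    · intro n hn
      refine ContinuousOn.circleIntegrable hR.le fun z hz => ContinuousAt.continuousWithinAt ?_
      exact (continuousAt_zpow₀ _ _ (Or.inl (hsph z hz).1)).const_mul _
  have h1 := circleIntegral.integral_sub (f := fun z => f z - S z) (hcf.sub hcS) hcT
  rw [circleIntegral.integral_sub hcf hcS, hiS, hiT] at h1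
  have h2 := h1.symm.trans hmain
  linear_combination h2

theorem ee_add (a b : ℂ) : ee (a + b) = ee a * ee b := by
  simp only [ee, mul_add, Complex.exp_add]

theorem ee_neg (a : ℂ) : ee (-a) = (ee a)⁻¹ := by
  simp only [ee, mul_neg, Complex.exp_neg]

theorem ee_eq_one_iff (ζ : ℂ) : ee ζ = 1 ↔ ∃ n : ℤ, ζ = n := by
  have h : (2 * (π : ℂ) * I) ≠ 0 := Complex.two_pi_I_ne_zero
  rw [ee, Complex.exp_eq_one_iff]
  refine exists_congr fun n => ⟨fun h' => mul_left_cancel₀ h (by rw [h']; ring), fun h' => by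
    rw [h']; ring⟩

theorem ee_intCast (n : ℤ) : ee n = 1 := (ee_eq_one_iff _).2 ⟨n, rfl⟩

theorem ee_natCast_mul (n : ℕ) (ζ : ℂ) : ee (n * ζ) = ee ζ ^ n := by
  rw [ee, ee, ← Complex.exp_nat_mul]; congr 1; ring

theorem norm_ee (ζ : ℂ) : ‖ee ζ‖ = Real.exp (-(2 * π * ζ.im)) := by
  rw [ee, Complex.norm_exp]; congr 1; simp

theorem hasDerivAt_ee (ζ : ℂ) : HasDerivAt ee (2 * π * I * ee ζ) ζ := by
  have h : HasDerivAt (fun s : ℂ => 2 * (π : ℂ) * I * s) (2 * π * I) ζ := by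
    simpa using (hasDerivAt_id ζ).const_mul (2 * (π : ℂ) * I)
  have h' := h.cexp
  rw [ee, mul_comm]
  exact h'

theorem differentiable_ee : Differentiable ℂ ee := fun ζ => (hasDerivAt_ee ζ).differentiableAt

/-- The function `1 / (e(ζ) - 1)`, with simple poles at the integers. -/
def eeKer (ζ : ℂ) : ℂ := (ee ζ - 1)⁻¹

theorem differentiableAt_eeKer {ζ : ℂ} (h : ∀ n : ℤ, ζ ≠ n) : DifferentiableAt ℂ eeKer ζ := by
  refine ((differentiable_ee ζ).sub_const 1).inv ?_
  rw [sub_ne_zero, Ne, ee_eq_one_iff]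
  push Not
  exact h

open Filter Topology in
theorem tendsto_sub_mul_eeKer {p s t : ℂ} (hs : s ≠ 0) {n : ℤ} (hp : s * p + t = n) :
    Tendsto (fun z => (z - p) * eeKer (s * z + t)) (𝓝[≠] p) (𝓝 (2 * π * I * s)⁻¹) := by
  have h1 : HasDerivAt (fun z => ee (s * z + t)) (2 * π * I * s) p := by
    have h2 : HasDerivAt (fun z => s * z + t) s p := by
      simpa using ((hasDerivAt_id p).const_mul s).add_const t
    have := (hasDerivAt_ee (s * p + t)).comp p h2
    rw [hp, ee_intCast, mul_one] at this
    exact this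
  have h3 := (hasDerivAt_iff_tendsto_slope.1 h1).inv₀ (mul_ne_zero Complex.two_pi_I_ne_zero hs)
  refine h3.congr fun z => ?_
  simp only [slope, vsub_eq_sub, smul_eq_mul, eeKer]
  rw [hp, ee_intCast, mul_inv, inv_inv]

/-- Away from the integers, `e(ζ) - 1` is bounded below by a multiple of `max 1 ‖e(ζ)‖`. -/
theorem exists_max_one_norm_ee_le {c : ℝ} (hc : 0 < c) :
    ∃ C : ℝ, 0 < C ∧ ∀ ζ : ℂ, (∀ n : ℤ, c ≤ ‖ζ - n‖) → max 1 ‖ee ζ‖ * ‖eeKer ζ‖ ≤ C := by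
  set K : Set ℂ := ((Set.Icc (-(1 / 2)) (1 / 2 : ℝ)) ×ℂ (Set.Icc (-1) (1 : ℝ))) ∩
    {ζ | c ≤ ‖ζ‖} with hK
  have hKc : IsCompact K := (isCompact_Icc.reProdIm isCompact_Icc).inter_right
    (isClosed_le continuous_const continuous_norm)
  have hKn : ∀ ζ ∈ K, ∀ n : ℤ, ζ ≠ n := by
    rintro ζ ⟨⟨hre, -⟩, hcn⟩ n rfl
    simp only [Set.mem_preimage, Complex.intCast_re, Set.mem_Icc] at hre
    have h1 : (-1 : ℝ) < n := by linarith [hre.1]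
    have h2 : (n : ℝ) < 1 := by linarith [hre.2]
    have h3 : -1 < n := by exact_mod_cast h1
    have h4 : n < 1 := by exact_mod_cast h2
    have : n = 0 := by omega
    subst this
    simp at hcn
    linarith
  have hcont : ContinuousOn (fun ζ => max 1 ‖ee ζ‖ * ‖eeKer ζ‖) K := by
    refine ContinuousOn.mul ?_ ?_
    · exact (continuous_const.max differentiable_ee.continuous.norm).continuousOn
    · exact fun ζ hζ => (differentiableAt_eeKer (hKn ζ hζ)).continuousAt.norm.continuousWithinAt
  obtain ⟨C, hC⟩ := hKc.exists_bound_of_continuousOn hcont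
  refine ⟨max C 2, by positivity, fun ζ hζ => ?_⟩
  have htwo : (2 : ℝ) ≤ Real.exp (2 * π) := by
    have := Real.add_one_le_exp (2 * π)
    have := Real.pi_gt_three
    linarith
  by_cases him : |ζ.im| ≤ 1
  · set ζ' : ℂ := ζ - round ζ.re with hζ'
    have he : ee ζ' = ee ζ := by
      rw [hζ', sub_eq_add_neg, ee_add, ee_neg, ee_intCast]; simp
    have hk : eeKer ζ = eeKer ζ' := by rw [eeKer, eeKer, he]
    rw [← he, hk]
    refine le_trans (le_trans (le_abs_self _) (hC ζ' ?_)) (le_max_left _ _)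
    refine ⟨⟨?_, ?_⟩, hζ _⟩
    · have := abs_sub_round ζ.re
      simp only [Set.mem_preimage, hζ', Complex.sub_re, Complex.intCast_re, Set.mem_Icc]
      exact abs_le.1 this
    · simp only [Set.mem_preimage, hζ', Complex.sub_im, Complex.intCast_im, sub_zero, Set.mem_Icc]
      exact abs_le.1 him
  · refine le_trans ?_ (le_max_right _ _)
    have hlow := abs_norm_sub_norm_le (ee ζ) 1
    rw [norm_one] at hlow
    have hpi := Real.pi_pos
    rw [eeKer, norm_inv]
    rcases lt_abs.1 (not_le.1 him) with h | h
    · have hE : ‖ee ζ‖ ≤ 1 / 2 := by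
        rw [norm_ee, Real.exp_neg, one_div]
        refine inv_anti₀ two_pos (htwo.trans (Real.exp_le_exp.2 ?_))
        nlinarith
      have h1 : 1 / 2 ≤ ‖ee ζ - 1‖ := by
        have := neg_le_abs (‖ee ζ‖ - 1)
        linarith
      rw [max_eq_left (by linarith), one_mul]
      calc ‖ee ζ - 1‖⁻¹ ≤ (1 / 2 : ℝ)⁻¹ := inv_anti₀ (by norm_num) h1
        _ = 2 := by norm_num
    · have hE : 2 ≤ ‖ee ζ‖ := by
        rw [norm_ee]
        refine htwo.trans (Real.exp_le_exp.2 ?_)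
        nlinarith
      have h1 : ‖ee ζ‖ / 2 ≤ ‖ee ζ - 1‖ := by
        have := le_abs_self (‖ee ζ‖ - 1)
        linarith
      rw [max_eq_right (by linarith), ← div_eq_mul_inv, div_le_iff₀ (by linarith)]
      linarith

/-- Four arithmetic progressions leave room for arbitrarily large radii keeping a fixed distance
from all of them. -/
theorem exists_radius_far (S : Fin 4 → Set ℝ) {d : ℝ} (hd : 0 < d)
    (hS : ∀ i, ∀ x ∈ S i, ∀ y ∈ S i, x ≠ y → d ≤ |x - y|) (T : ℝ) :
    ∃ R, T ≤ R ∧ ∀ i, ∀ x ∈ S i, d / 12 ≤ |R - x| := by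
  by_contra! hcon
  have h1 : ∀ j : Fin 5, ∃ i : Fin 4, ∃ x ∈ S i, |T + (j : ℕ) * (d / 6) - x| < d / 12 := fun j =>
    hcon _ (by have : (0 : ℝ) ≤ (j : ℕ) * (d / 6) := by positivity
               linarith)
  choose i x hx hlt using h1
  obtain ⟨j, j', hne, hij⟩ := Fintype.exists_ne_map_eq_of_card_lt i (by simp)
  have hj : ((j : ℕ) : ℝ) ≠ ((j' : ℕ) : ℝ) := fun h => hne (Fin.ext (by exact_mod_cast h))
  have hb : ∀ a b : Fin 5, |((a : ℕ) : ℝ) - ((b : ℕ) : ℝ)| ≤ 4 := fun a b => by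
    have ha : ((a : ℕ) : ℝ) ≤ 4 := by exact_mod_cast (by omega : (a : ℕ) ≤ 4)
    have hb : ((b : ℕ) : ℝ) ≤ 4 := by exact_mod_cast (by omega : (b : ℕ) ≤ 4)
    rw [abs_le]
    constructor <;> linarith [Nat.cast_nonneg (α := ℝ) (a : ℕ), Nat.cast_nonneg (α := ℝ) (b : ℕ)]
  have h2 := hlt j
  have h3 := hlt j'
  by_cases hxx : x j = x j'
  · rw [hxx] at h2
    have h4 : |((j : ℕ) : ℝ) - ((j' : ℕ) : ℝ)| < 1 := by
      have : |(((j : ℕ) : ℝ) - ((j' : ℕ) : ℝ)) * (d / 6)| < d / 6 := by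
        rw [abs_lt] at h2 h3 ⊢
        constructor <;> linarith
      rw [abs_mul, abs_of_pos (by positivity : 0 < d / 6)] at this
      by_contra! h
      nlinarith
    have h5 : |((j : ℕ) : ℤ) - ((j' : ℕ) : ℤ)| < 1 := by exact_mod_cast h4
    rw [Int.abs_lt_one_iff] at h5
    exact hj (by exact_mod_cast sub_eq_zero.1 h5)
  · have h4 := hS (i j) (x j) (hx j) (x j') (hij ▸ hx j') hxx
    have h5 := hb j j'
    rw [abs_lt] at h2 h3
    rw [abs_le] at h5
    have : |x j - x j'| < d := by
      rw [abs_lt]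
      constructor <;> nlinarith
    linarith

open Filter Topology in
theorem tendsto_mul_sub_of_hasSum {f : ℂ → ℂ} {M : ℕ} {d : ℕ → ℂ}
    (h : ∀ᶠ z in 𝓝[≠] (0 : ℂ), HasSum (fun n => d n * z ^ n) (z ^ M * f z)) :
    Tendsto (fun z => z * (f z - ∑ n ∈ Finset.range M, d n * z ^ ((n : ℤ) - M)))
      (𝓝[≠] 0) (𝓝 0) := by
  set φ : ℂ → ℂ := fun z => if z = 0 then d 0 else z ^ M * f z with hφ
  set p : FormalMultilinearSeries ℂ ℂ ℂ := fun n =>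
    ContinuousMultilinearMap.mkPiRing ℂ (Fin n) (d n)
  have hps : HasFPowerSeriesAt φ p 0 := by
    rw [hasFPowerSeriesAt_iff]
    rw [eventually_nhdsWithin_iff] at h
    filter_upwards [h] with z hz
    have hc : ∀ n, p.coeff n = d n := fun n => by simp [p, FormalMultilinearSeries.coeff]
    simp only [hc, zero_add, smul_eq_mul]
    by_cases h0 : z = 0
    · subst h0
      simp only [hφ, if_true]
      have := hasSum_single (f := fun n => (0 : ℂ) ^ n * d n) 0 (fun n hn => by simp [hn])
      simpa using this
    · simp only [hφ, if_neg h0]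
      simpa [mul_comm] using hz h0
  have hO := hps.isBigO_sub_partialSum_pow M
  simp only [zero_add] at hO
  have hO' : (fun z => φ z - ∑ n ∈ Finset.range M, d n * z ^ n) =O[𝓝[≠] 0] fun z => z ^ M := by
    have := hO.mono (nhdsWithin_le_nhds (s := {(0 : ℂ)}ᶜ))
    simp only [FormalMultilinearSeries.partialSum, p, ContinuousMultilinearMap.mkPiRing_apply,
      Finset.prod_const, Finset.card_univ, Fintype.card_fin, smul_eq_mul] at this
    simp only [mul_comm (d _)]
    refine this.trans (Asymptotics.isBigO_of_le _ fun z => by simp)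
  have hid : Tendsto (fun z : ℂ => z) (𝓝[≠] 0) (𝓝 0) := nhdsWithin_le_nhds
  have h3 : (fun z => f z - ∑ n ∈ Finset.range M, d n * z ^ ((n : ℤ) - M)) =O[𝓝[≠] 0]
      fun _ => (1 : ℂ) := by
    have h4 := hO'.mul (Asymptotics.isBigO_refl (fun z : ℂ => (z ^ M)⁻¹) (𝓝[≠] 0))
    refine (h4.congr' ?_ ?_)
    · filter_upwards [self_mem_nhdsWithin] with z (hz : z ≠ 0)
      simp only [hφ, if_neg hz, sub_mul, Finset.sum_mul]
      congr 1
      · field_simp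
      · refine Finset.sum_congr rfl fun n _ => ?_
        rw [zpow_sub₀ hz, zpow_natCast, zpow_natCast]; ring
    · filter_upwards [self_mem_nhdsWithin] with z (hz : z ≠ 0)
      field_simp
  have h5 := (Asymptotics.isLittleO_one_iff ℂ).2 hid
  have h6 := h5.mul_isBigO h3
  simp only [mul_one] at h6
  exact (Asymptotics.isLittleO_one_iff ℂ).1 h6

open Filter Topology in
theorem tendsto_sum_abs_lt {α : Type*} [AddCommMonoid α] [TopologicalSpace α] {F : ℤ → α} {a : α}
    (hF : HasSum F a) (t : ℝ) {R : ℕ → ℝ} (hR : Tendsto R atTop atTop) {s : ℕ → Finset ℤ}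
    (hs : ∀ N n, n ∈ s N ↔ |(n : ℝ) + t| < R N) :
    Tendsto (fun N => ∑ n ∈ s N, F n) atTop (𝓝 a) := by
  refine Tendsto.comp (g := fun s : Finset ℤ => ∑ n ∈ s, F n) hF ?_
  rw [SummationFilter.unconditional_filter, tendsto_atTop]
  intro u
  have : ∀ n ∈ u, ∀ᶠ N in atTop, n ∈ s N := fun n _ => by
    filter_upwards [hR.eventually_gt_atTop |(n : ℝ) + t|] with N hN
    exact (hs N n).2 hN
  filter_upwards [(Finset.eventually_all u).2 this] with N hN n hn using hN n hn

theorem finite_abs_intCast_add_lt (t R : ℝ) : {n : ℤ | |(n : ℝ) + t| < R}.Finite := by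
  refine (Set.finite_Icc (⌊-R - t⌋) (⌈R - t⌉)).subset fun n hn => ?_
  have h := abs_lt.1 (show |(n : ℝ) + t| < R from hn)
  constructor
  · have : ((⌊-R - t⌋ : ℤ) : ℝ) ≤ n := (Int.floor_le _).trans (by linarith)
    exact_mod_cast this
  · have : (n : ℝ) ≤ ((⌈R - t⌉ : ℤ) : ℝ) := le_trans (by linarith) (Int.le_ceil _)
    exact_mod_cast this

theorem exists_radius_far_from_poles (μ ν : ℝ) {s : ℝ} (hs : 0 < s) :
    ∃ c, 0 < c ∧ ∀ T : ℝ, ∃ R, T ≤ R ∧ (∀ n : ℤ, c ≤ |R - (|(n : ℝ) + -μ|)|) ∧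
      (∀ n : ℤ, c ≤ |R - |(n : ℝ) + ν| / s|) := by
  have hd : 0 < min 1 (1 / s) := by positivity
  set S : Fin 4 → Set ℝ :=
    ![Set.range fun n : ℤ => (n : ℝ) + -μ, Set.range fun n : ℤ => -((n : ℝ) + -μ),
      Set.range fun n : ℤ => ((n : ℝ) + ν) / s, Set.range fun n : ℤ => -((n : ℝ) + ν) / s] with hS
  have hint : ∀ n m : ℤ, n ≠ m → (1 : ℝ) ≤ |(n : ℝ) - m| := fun n m h => by
    have := Int.one_le_abs (sub_ne_zero.2 h)
    exact_mod_cast this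
  have hsep : ∀ i, ∀ x ∈ S i, ∀ y ∈ S i, x ≠ y → min 1 (1 / s) ≤ |x - y| := by
    intro i
    fin_cases i <;> rintro _ ⟨n, rfl⟩ _ ⟨m, rfl⟩ hne <;>
      have hnm : n ≠ m := (fun h => hne (by rw [h])) <;> have h1 := hint n m hnm
    · refine (min_le_left _ _).trans ?_
      simpa using h1
    · refine (min_le_left _ _).trans ?_
      simp only
      rwa [abs_sub_comm, neg_sub_neg, add_sub_add_right_eq_sub]
    · refine (min_le_right _ _).trans ?_
      simp only
      rw [← sub_div, add_sub_add_right_eq_sub, abs_div, abs_of_pos hs]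
      gcongr
    · refine (min_le_right _ _).trans ?_
      simp only
      rw [abs_sub_comm, ← sub_div, neg_sub_neg, add_sub_add_right_eq_sub, abs_div, abs_of_pos hs]
      gcongr
  refine ⟨min 1 (1 / s) / 12, by positivity, fun T => ?_⟩
  obtain ⟨R, hTR, hR⟩ := exists_radius_far S hd hsep T
  refine ⟨R, hTR, fun n => ?_, fun n => ?_⟩
  · rcases abs_choice ((n : ℝ) + -μ) with h | h <;> rw [h]
    · exact hR 0 _ ⟨n, rfl⟩
    · exact hR 1 _ ⟨n, rfl⟩
  · rcases abs_choice ((n : ℝ) + ν) with h | h <;> rw [h]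
    · exact hR 2 _ ⟨n, rfl⟩
    · exact hR 3 _ ⟨n, rfl⟩

theorem differentiableAt_eeKer_comp {s t z : ℂ} (h : ∀ n : ℤ, s * z + t ≠ n) :
    DifferentiableAt ℂ (fun z => eeKer (s * z + t)) z :=
  DifferentiableAt.comp (g := eeKer) z (differentiableAt_eeKer h)
    ((differentiableAt_id.const_mul s).add_const t)

theorem differentiableAt_eeKer_add {t z : ℂ} (h : ∀ n : ℤ, z + t ≠ n) :
    DifferentiableAt ℂ (fun z => eeKer (z + t)) z :=
  DifferentiableAt.comp (g := eeKer) z (differentiableAt_eeKer h) (differentiableAt_id.add_const t)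

theorem norm_ee_add_ofReal (z : ℂ) (x : ℝ) : ‖ee (z + x)‖ = ‖ee z‖ := by
  simp [norm_ee]

theorem ne_intCast_of_im_ne_zero {z : ℂ} (hz : z.im ≠ 0) (x : ℝ) (n : ℤ) : z + x ≠ n := fun h => by
  have := congrArg Complex.im h
  simp at this
  exact hz this

theorem mul_ofReal_im_ne_zero {σ : ℂ} (hσ : 0 < σ.im) {x : ℝ} (hx : x ≠ 0) : (σ * x).im ≠ 0 := by
  simpa using ⟨hσ.ne', hx⟩

theorem neg_ofReal_div_im_ne_zero {σ : ℂ} (hσ : 0 < σ.im) {x : ℝ} (hx : x ≠ 0) :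
    (-(x : ℂ) / σ).im ≠ 0 := fun h => by
  have hσ0 : σ ≠ 0 := fun h0 => by simp [h0] at hσ
  have h1 : -(x : ℂ) = σ * (-(x : ℂ) / σ) := by field_simp
  have h2 : -(x : ℂ) / σ = (((-(x : ℂ) / σ).re : ℝ) : ℂ) := Complex.ext rfl (by simpa using h)
  rw [h2] at h1
  have h3 := congrArg Complex.im h1
  simp only [neg_im, ofReal_im, neg_zero, mul_im, ofReal_re, mul_zero, zero_add] at h3
  have h4 : (-(x : ℂ) / σ).re = 0 := by
    rcases mul_eq_zero.1 h3.symm with h | h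
    · exact absurd h hσ.ne'
    · exact h
  rw [h4, ofReal_zero, div_eq_zero_iff] at h2
  rcases h2 with h | h
  · exact hx (by simpa using h)
  · exact hσ0 h

open Filter Topology in
theorem tendsto_circleIntegral_zero {μ ν : ℝ} {σ : ℂ} (hσ : σ ≠ 0) {g : ℂ → ℂ} {c : ℝ} (hc : 0 < c)
    (hdecay : Tendsto (fun z => ‖g z‖ * ‖z‖ / (max 1 ‖ee z‖ * max 1 ‖ee (σ * z)‖))
      (Bornology.cobounded ℂ) (𝓝 0)) {R : ℕ → ℝ} (hR0 : ∀ N, 0 < R N) (hR : Tendsto R atTop atTop)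
    (hR1 : ∀ N, ∀ n : ℤ, c ≤ |R N - (|(n : ℝ) + -μ|)|)
    (hR2 : ∀ N, ∀ n : ℤ, c ≤ |R N - |(n : ℝ) + ν| / ‖σ‖|) :
    Tendsto (fun N => ∮ z in C(0, R N), g z * eeKer (z + μ) * eeKer (σ * z + ν)) atTop (𝓝 0) := by
  have hσn : 0 < ‖σ‖ := norm_pos_iff.2 hσ
  obtain ⟨C₁, hC₁, hK₁⟩ := exists_max_one_norm_ee_le hc
  obtain ⟨C₂, hC₂, hK₂⟩ := exists_max_one_norm_ee_le (mul_pos hσn hc)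
  have hbound : ∀ N, ∀ z : ℂ, ‖z‖ = R N → ‖g z * eeKer (z + μ) * eeKer (σ * z + ν)‖ * R N ≤
      C₁ * C₂ * (‖g z‖ * ‖z‖ / (max 1 ‖ee z‖ * max 1 ‖ee (σ * z)‖)) := by
    intro N z hz
    have h1 := hK₁ (z + μ) fun n => by
      refine (hR1 N n).trans ?_
      have h := abs_norm_sub_norm_le z (((n : ℝ) + -μ : ℝ) : ℂ)
      rw [hz, Complex.norm_real, Real.norm_eq_abs] at h
      refine h.trans_eq ?_
      congr 1
      push_cast
      ring
    have h2 := hK₂ (σ * z + ν) fun n => by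
      have h := abs_norm_sub_norm_le z (((((-n : ℤ) : ℝ) + ν : ℝ) : ℂ) / -σ)
      rw [hz, norm_div, Complex.norm_real, Real.norm_eq_abs, norm_neg] at h
      calc ‖σ‖ * c ≤ ‖σ‖ * ‖z - ((((-n : ℤ) : ℝ) + ν : ℝ) : ℂ) / -σ‖ := by
            gcongr
            exact (hR2 N (-n)).trans h
        _ = ‖σ * z + ν - n‖ := by
            rw [← norm_mul]
            congr 1
            field_simp
            push_cast
            ring
    rw [norm_ee_add_ofReal] at h1 h2
    have h3 : 0 < max 1 ‖ee z‖ := by positivity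
    have h4 : 0 < max 1 ‖ee (σ * z)‖ := by positivity
    rw [norm_mul, norm_mul, ← hz, mul_div_assoc', le_div_iff₀ (by positivity)]
    calc ‖g z‖ * ‖eeKer (z + μ)‖ * ‖eeKer (σ * z + ν)‖ * ‖z‖ * (max 1 ‖ee z‖ * max 1 ‖ee (σ * z)‖)
        = (max 1 ‖ee z‖ * ‖eeKer (z + μ)‖) * (max 1 ‖ee (σ * z)‖ * ‖eeKer (σ * z + ν)‖) *
          (‖g z‖ * ‖z‖) := by ring
      _ ≤ C₁ * C₂ * (‖g z‖ * ‖z‖) := by gcongr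
  rw [Metric.tendsto_atTop']
  intro ε hε
  have hε' : 0 < ε / (2 * π * (C₁ * C₂) + 1) := by positivity
  have hev := hdecay.eventually (gt_mem_nhds hε')
  obtain ⟨T, hT⟩ := (Filter.hasBasis_cobounded_norm.eventually_iff.1 hev)
  obtain ⟨N₀, hN₀⟩ := (hR.eventually_ge_atTop T).exists_forall_of_atTop
  refine ⟨N₀, fun N hN => ?_⟩
  rw [dist_zero_right]
  have hb : ∀ z ∈ Metric.sphere (0 : ℂ) (R N), ‖g z * eeKer (z + μ) * eeKer (σ * z + ν)‖ ≤
      C₁ * C₂ * (ε / (2 * π * (C₁ * C₂) + 1)) / R N := fun z hz => by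
    rw [mem_sphere_zero_iff_norm] at hz
    rw [le_div_iff₀ (hR0 N)]
    refine (hbound N z hz).trans ?_
    refine mul_le_mul_of_nonneg_left ?_ (by positivity)
    exact (hT.2 (show T ≤ ‖z‖ by rw [hz]; exact hN₀ N hN.le)).le
  refine (circleIntegral.norm_integral_le_of_norm_le_const (hR0 N).le hb).trans_lt ?_
  have := (hR0 N).ne'
  calc 2 * π * R N * (C₁ * C₂ * (ε / (2 * π * (C₁ * C₂) + 1)) / R N)
      = ε * ((2 * π * (C₁ * C₂)) / (2 * π * (C₁ * C₂) + 1)) := by field_simp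
    _ < ε * 1 := by
        gcongr
        rw [div_lt_one (by positivity)]
        linarith
    _ = ε := mul_one ε

open Filter Topology Metric in
/-- The residue theorem for `g(z) / ((e(z+μ) - 1) (e(σz+ν) - 1))`, where `g` is holomorphic away
from `0`: the residues at the two families of real and non-real poles and the one at `0`
add up to zero. -/
theorem sum_residues_eq_zero {μ ν : ℝ} {σ : ℂ} (hσ : 0 < σ.im) {g : ℂ → ℂ}
    (hg : ∀ z, z ≠ 0 → DifferentiableAt ℂ g z) {M : ℕ} (hM : 1 ≤ M) {d : ℕ → ℂ}
    (hd : ∀ᶠ z in 𝓝[≠] (0 : ℂ), HasSum (fun n => d n * z ^ n)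
      (z ^ M * (g z * eeKer (z + μ) * eeKer (σ * z + ν))))
    (hdecay : Tendsto (fun z => ‖g z‖ * ‖z‖ / (max 1 ‖ee z‖ * max 1 ‖ee (σ * z)‖))
      (Bornology.cobounded ℂ) (𝓝 0)) {S₁ S₂ : ℂ}
    (h1 : HasSum (fun n : ℤ => if (n : ℝ) + -μ = 0 then 0 else
      g (((n : ℝ) + -μ : ℝ) : ℂ) * eeKer (σ * (((n : ℝ) + -μ : ℝ) : ℂ) + ν)) S₁)
    (h2 : HasSum (fun n : ℤ => if (n : ℝ) + ν = 0 then 0 else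
      g (-(((n : ℝ) + ν : ℝ) : ℂ) / σ) * eeKer (-(((n : ℝ) + ν : ℝ) : ℂ) / σ + μ)) S₂) :
    S₁ + σ⁻¹ * S₂ + 2 * π * I * d (M - 1) = 0 := by
  have hσ0 : σ ≠ 0 := fun h0 => by simp [h0] at hσ
  have hσn : 0 < ‖σ‖ := norm_pos_iff.2 hσ0
  obtain ⟨c, hc, hrad⟩ := exists_radius_far_from_poles μ ν hσn
  choose R hRN hR1 hR2 using fun N : ℕ => hrad (N + 1)
  have hR0 : ∀ N, 0 < R N := fun N => lt_of_lt_of_le (by positivity) (hRN N)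
  have hR : Tendsto R atTop atTop := tendsto_atTop_mono
    (fun N => (by linarith [hRN N] : (N : ℝ) ≤ R N)) tendsto_natCast_atTop_atTop
  set p₁ : ℤ → ℂ := fun n => (((n : ℝ) + -μ : ℝ) : ℂ) with hp₁
  set p₂ : ℤ → ℂ := fun n => -(((n : ℝ) + ν : ℝ) : ℂ) / σ with hp₂
  set f : ℂ → ℂ := fun z => g z * eeKer (z + μ) * eeKer (σ * z + ν) with hf
  set s₁ : ℕ → Finset ℤ := fun N => (finite_abs_intCast_add_lt (-μ) (R N)).toFinset with hs₁
  set s₂ : ℕ → Finset ℤ := fun N => (finite_abs_intCast_add_lt ν (R N * ‖σ‖)).toFinset with hs₂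
  have hms₁ : ∀ N n, n ∈ s₁ N ↔ |(n : ℝ) + -μ| < R N := fun N n => by simp [hs₁]
  have hms₂ : ∀ N n, n ∈ s₂ N ↔ |(n : ℝ) + ν| < R N * ‖σ‖ := fun N n => by simp [hs₂]
  set r : ℂ → ℂ := fun p => if p.im = 0 then (2 * π * I)⁻¹ * (g p * eeKer (σ * p + ν)) else
    (2 * π * I)⁻¹ * (σ⁻¹ * (g p * eeKer (p + μ))) with hr
  have him₁ : ∀ n, (p₁ n).im = 0 := fun n => Complex.ofReal_im _
  have him₂ : ∀ n : ℤ, (n : ℝ) + ν ≠ 0 → (p₂ n).im ≠ 0 := fun n h => neg_ofReal_div_im_ne_zero hσ h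
  have hinj₁ : Function.Injective p₁ := fun a b h => by simpa [hp₁] using h
  have hinj₂ : Function.Injective p₂ := fun a b h => by
    simp only [hp₂] at h
    rw [div_left_inj' hσ0, neg_inj, Complex.ofReal_inj, add_left_inj] at h
    exact_mod_cast h
  have hnorm₁ : ∀ n, ‖p₁ n‖ = |(n : ℝ) + -μ| := fun n => by
    rw [hp₁, Complex.norm_real, Real.norm_eq_abs]
  have hnorm₂ : ∀ n, ‖p₂ n‖ = |(n : ℝ) + ν| / ‖σ‖ := fun n => by
    simp only [hp₂]
    rw [norm_div, norm_neg, Complex.norm_real, Real.norm_eq_abs]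
  set P₁ : ℕ → Finset ℂ := fun N => ((s₁ N).filter fun n : ℤ => ¬ (n : ℝ) + -μ = 0).image p₁ with hP₁
  set P₂ : ℕ → Finset ℂ := fun N => ((s₂ N).filter fun n : ℤ => ¬ (n : ℝ) + ν = 0).image p₂ with hP₂
  have hmP₁ : ∀ N p, p ∈ P₁ N ↔ ∃ n : ℤ, (|(n : ℝ) + -μ| < R N ∧ (n : ℝ) + -μ ≠ 0) ∧ p₁ n = p :=
    fun N p => by simp only [hP₁, Finset.mem_image, Finset.mem_filter, hms₁, Ne]
  have hmP₂ : ∀ N p, p ∈ P₂ N ↔ ∃ n : ℤ, (|(n : ℝ) + ν| < R N * ‖σ‖ ∧ (n : ℝ) + ν ≠ 0) ∧ p₂ n = p :=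
    fun N p => by simp only [hP₂, Finset.mem_image, Finset.mem_filter, hms₂, Ne]
  have hint : ∀ N, (∮ z in C(0, R N), f z) =
      ∑ n ∈ s₁ N, (if (n : ℝ) + -μ = 0 then 0 else g (p₁ n) * eeKer (σ * p₁ n + ν)) +
      σ⁻¹ * ∑ n ∈ s₂ N, (if (n : ℝ) + ν = 0 then 0 else g (p₂ n) * eeKer (p₂ n + μ)) +
      2 * π * I * d (M - 1) := by
    intro N
    have hdisj : Disjoint (P₁ N) (P₂ N) := by
      rw [Finset.disjoint_left]
      intro p h1 h2
      obtain ⟨n, -, rfl⟩ := (hmP₁ N p).1 h1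
      obtain ⟨m, ⟨-, hm⟩, h⟩ := (hmP₂ N _).1 h2
      exact him₂ m hm (h ▸ him₁ n)
    have hdiff : ∀ z ∈ closedBall (0 : ℂ) (R N), z ≠ 0 → z ∉ P₁ N ∪ P₂ N →
        DifferentiableAt ℂ f z := by
      intro z hz hz0 hzP
      rw [mem_closedBall_zero_iff] at hz
      rw [Finset.mem_union, not_or, hmP₁ N, hmP₂ N] at hzP
      have hA : DifferentiableAt ℂ (fun z => eeKer (z + μ)) z := by
        refine differentiableAt_eeKer_add fun n hn => hzP.1 ?_
        have hzn : p₁ n = z := by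
          simp only [hp₁]; push_cast; rw [← hn]; simp
        refine ⟨n, ⟨?_, fun h => hz0 ?_⟩, hzn⟩
        · rw [← hnorm₁, hzn]
          refine lt_of_le_of_ne hz fun h => ?_
          have := hR1 N n
          rw [← hnorm₁, hzn, h, sub_self, abs_zero] at this
          linarith
        · rw [← hzn]; simp only [hp₁]; rw [h, Complex.ofReal_zero]
      have hB : DifferentiableAt ℂ (fun z => eeKer (σ * z + ν)) z := by
        refine differentiableAt_eeKer_comp fun n hn => hzP.2 ?_
        have hzn : p₂ (-n) = z := by
          simp only [hp₂]
          rw [div_eq_iff hσ0]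
          push_cast
          rw [← hn]
          ring
        refine ⟨-n, ⟨?_, fun h => hz0 ?_⟩, hzn⟩
        · rw [← div_lt_iff₀ hσn, ← hnorm₂, hzn]
          refine lt_of_le_of_ne hz fun h => ?_
          have := hR2 N (-n)
          rw [← hnorm₂, hzn, h, sub_self, abs_zero] at this
          linarith
        · rw [← hzn]; simp only [hp₂]; rw [h, Complex.ofReal_zero, neg_zero, zero_div]
      exact ((hg z hz0).mul hA).mul hB
    have hP₁0 : ∀ p ∈ P₁ N, p ≠ 0 := fun p hp h0 => by
      obtain ⟨n, ⟨-, hn⟩, rfl⟩ := (hmP₁ N p).1 hp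
      exact hn (Complex.ofReal_eq_zero.1 h0)
    have hP₂0 : ∀ p ∈ P₂ N, p ≠ 0 := fun p hp h0 => by
      obtain ⟨n, ⟨-, hn⟩, rfl⟩ := (hmP₂ N p).1 hp
      exact him₂ n hn (by rw [h0]; rfl)
    rw [circleIntegral_eq_sum_residues (hR0 N) (P₁ N ∪ P₂ N) ?_ ?_ hdiff r ?_ M hM d
      (tendsto_mul_sub_of_hasSum hd), Finset.sum_union hdisj, hP₁, hP₂,
      Finset.sum_image hinj₁.injOn, Finset.sum_image hinj₂.injOn, mul_add, mul_add]
    · congr 2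
      · rw [Finset.sum_filter, Finset.mul_sum]
        refine Finset.sum_congr rfl fun n _ => ?_
        by_cases hn : (n : ℝ) + -μ = 0
        · simp only [hn, not_true, if_true, if_false, mul_zero]
        · simp only [hn, not_false_eq_true, if_true, if_false, hr, him₁]
          rw [mul_inv_cancel_left₀ Complex.two_pi_I_ne_zero]
      · rw [Finset.sum_filter, Finset.mul_sum, Finset.mul_sum]
        refine Finset.sum_congr rfl fun n _ => ?_
        by_cases hn : (n : ℝ) + ν = 0
        · simp only [hn, not_true, if_true, if_false, mul_zero]
        · simp only [hn, not_false_eq_true, if_true, if_false, hr, him₂ n hn]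
          rw [mul_inv_cancel_left₀ Complex.two_pi_I_ne_zero]
    · intro p hp
      rw [mem_ball_zero_iff]
      rcases Finset.mem_union.1 hp with hp | hp
      · obtain ⟨n, ⟨hn, -⟩, rfl⟩ := (hmP₁ N p).1 hp
        rwa [hnorm₁]
      · obtain ⟨n, ⟨hn, -⟩, rfl⟩ := (hmP₂ N p).1 hp
        rwa [hnorm₂, div_lt_iff₀ hσn]
    · intro h
      rcases Finset.mem_union.1 h with hp | hp
      · exact hP₁0 _ hp rfl
      · exact hP₂0 _ hp rfl
    · intro p hp
      rcases Finset.mem_union.1 hp with hp | hp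
      · have hp0 := hP₁0 p hp
        obtain ⟨n, ⟨-, hn⟩, rfl⟩ := (hmP₁ N p).1 hp
        have hlim := tendsto_sub_mul_eeKer (p := p₁ n) (s := 1) (t := μ) one_ne_zero (n := n)
          (by simp only [hp₁]; push_cast; ring)
        have hcont : ContinuousAt (fun z => g z * eeKer (σ * z + ν)) (p₁ n) :=
          ((hg _ hp0).mul (differentiableAt_eeKer_comp fun m =>
            ne_intCast_of_im_ne_zero (mul_ofReal_im_ne_zero hσ hn) ν m)).continuousAt
        have h3 := hlim.mul (hcont.tendsto.mono_left nhdsWithin_le_nhds)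
        simp only [hr, him₁, if_true]
        rw [mul_one] at h3
        refine h3.congr fun z => ?_
        simp only [hf, one_mul]
        ring
      · have hp0 := hP₂0 p hp
        obtain ⟨n, ⟨-, hn⟩, rfl⟩ := (hmP₂ N p).1 hp
        have hlim := tendsto_sub_mul_eeKer (p := p₂ n) (s := σ) (t := ν) hσ0 (n := -n)
          (by simp only [hp₂]; rw [mul_div_cancel₀ _ hσ0]; push_cast; ring)
        have hcont : ContinuousAt (fun z => g z * eeKer (z + μ)) (p₂ n) :=
          ((hg _ hp0).mul (differentiableAt_eeKer_add fun m =>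
            ne_intCast_of_im_ne_zero (him₂ n hn) μ m)).continuousAt
        have h3 := hlim.mul (hcont.tendsto.mono_left nhdsWithin_le_nhds)
        simp only [hr, him₂ n hn, if_false]
        rw [mul_inv, mul_assoc] at h3
        refine h3.congr fun z => ?_
        simp only [hf]
        ring
  have hlim : Tendsto (fun N => ∮ z in C(0, R N), f z) atTop
      (𝓝 (S₁ + σ⁻¹ * S₂ + 2 * π * I * d (M - 1))) := by
    simp only [hint]
    refine ((tendsto_sum_abs_lt h1 _ hR hms₁).add
      ((tendsto_sum_abs_lt h2 _ (hR.atTop_mul_const hσn) hms₂).const_mul _)).add_const _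
  exact tendsto_nhds_unique hlim (tendsto_circleIntegral_zero hσ0 hc hdecay hR0 hR hR1 hR2)

/-- The coefficients of the Cauchy product of two power series. -/
def cauchyCoeff (a b : ℕ → ℂ) (n : ℕ) : ℂ :=
  ∑ p ∈ Finset.HasAntidiagonal.antidiagonal n, a p.1 * b p.2

theorem hasSum_cauchyCoeff {a b : ℕ → ℂ} {x y z : ℂ} (ha : HasSum (fun n => a n * z ^ n) x)
    (hb : HasSum (fun n => b n * z ^ n) y) :
    HasSum (fun n => cauchyCoeff a b n * z ^ n) (x * y) := by
  have h : ∀ n, cauchyCoeff a b n * z ^ n =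
      ∑ p ∈ Finset.HasAntidiagonal.antidiagonal n, (a p.1 * z ^ p.1) * (b p.2 * z ^ p.2) :=
      fun n => by
    rw [cauchyCoeff, Finset.sum_mul]
    refine Finset.sum_congr rfl fun p hp => ?_
    rw [← Finset.HasAntidiagonal.mem_antidiagonal.1 hp, pow_add]
    ring
  simp only [h]
  rw [← ha.tsum_eq, ← hb.tsum_eq, tsum_mul_tsum_eq_tsum_sum_antidiagonal_of_summable_norm
    ha.summable.norm hb.summable.norm]
  exact (summable_norm_sum_mul_antidiagonal_of_summable_norm
    ha.summable.norm hb.summable.norm).of_norm.hasSum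

open Filter Topology in
theorem eventually_hasSum_mul_eeKer {a : ℕ → ℂ} {s t : ℂ} (hs : s ≠ 0)
    (ha : ∀ᶠ Z in 𝓝[≠] (0 : ℂ), HasSum (fun j : ℕ => a j * Z ^ j / (Nat.factorial j : ℂ))
      (Z / (ee t * Complex.exp Z - 1))) :
    ∀ᶠ z in 𝓝[≠] (0 : ℂ), HasSum
      (fun j : ℕ => (a j * (2 * π * I * s) ^ ((j : ℤ) - 1) / (Nat.factorial j : ℂ)) * z ^ j)
      (z * eeKer (s * z + t)) := by
  have hc : 2 * (π : ℂ) * I * s ≠ 0 := mul_ne_zero Complex.two_pi_I_ne_zero hs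
  have hlim : Tendsto (fun z : ℂ => 2 * (π : ℂ) * I * s * z) (𝓝[≠] 0) (𝓝[≠] 0) := by
    refine tendsto_nhdsWithin_of_tendsto_nhds_of_eventually_within _ ?_ ?_
    · have : ContinuousAt (fun z : ℂ => 2 * (π : ℂ) * I * s * z) 0 := by fun_prop
      simpa using this.tendsto.mono_left nhdsWithin_le_nhds
    · filter_upwards [self_mem_nhdsWithin] with z hz using mul_ne_zero hc hz
  filter_upwards [hlim.eventually ha] with z hz
  have h := hz.mul_left (2 * (π : ℂ) * I * s)⁻¹
  have hexp : ee (s * z + t) = ee t * Complex.exp (2 * π * I * s * z) := by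
    rw [ee_add, mul_comm]
    simp only [ee, mul_assoc]
  rw [div_eq_mul_inv, mul_assoc _ z, inv_mul_cancel_left₀ hc] at h
  rw [eeKer, hexp]
  refine Eq.subst (motive := fun f => HasSum f _) (funext fun j => ?_) h
  rw [zpow_sub_one₀ hc, zpow_natCast, mul_pow _ z]
  ring

theorem hasSum_exp_mul (w z : ℂ) :
    HasSum (fun n : ℕ => (w ^ n / (Nat.factorial n : ℂ)) * z ^ n) (Complex.exp (w * z)) := by
  have h := NormedSpace.expSeries_div_hasSum_exp (w * z)
  rw [← Complex.exp_eq_exp_ℂ] at h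
  refine Eq.subst (motive := fun f => HasSum f _) (funext fun n => ?_) h
  rw [mul_pow]
  ring

theorem cauchyCoeff_one (a b : ℕ → ℂ) : cauchyCoeff a b 1 = a 0 * b 1 + a 1 * b 0 := by
  simp [cauchyCoeff, Finset.Nat.antidiagonal_succ]

theorem fracP_eq (γ : ℝ) : fracP γ = γ + ⌊-γ⌋ + 1 := by
  rw [fracP, Int.fract]; ring

theorem fracP_pos (γ : ℝ) : 0 < fracP γ := by
  rw [fracP]; linarith [Int.fract_lt_one (-γ)]

theorem fracP_le_one (γ : ℝ) : fracP γ ≤ 1 := by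
  rw [fracP]; linarith [Int.fract_nonneg (-γ)]

theorem fracP_zero : fracP 0 = 1 := by simp [fracP]

/-- The enumeration of the integers `l` with `0 < γ + l` by the natural numbers. -/
def posEquiv (γ : ℝ) : ℕ ≃ {l : ℤ // 0 < γ + (l : ℝ)} where
  toFun m := ⟨m + ⌊-γ⌋ + 1, by
    have := fracP_pos γ
    rw [fracP_eq] at this
    push_cast
    have h : (0 : ℝ) ≤ m := m.cast_nonneg
    linarith⟩
  invFun l := (l.1 - ⌊-γ⌋ - 1).toNat
  left_inv m := by
    simp only
    omega
  right_inv l := by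
    have h : ⌊-γ⌋ < l.1 := Int.floor_lt.2 (by linarith [l.2])
    ext
    simp only
    omega

theorem add_posEquiv (γ : ℝ) (m : ℕ) : γ + ((posEquiv γ m).1 : ℝ) = m + fracP γ := by
  rw [fracP_eq]
  simp only [posEquiv, Equiv.coe_fn_mk]
  push_cast
  ring

theorem hasSum_lattice_pos {F : ℝ → ℂ} {γ : ℝ} {x : ℂ}
    (h : HasSum (fun m : ℕ => F (m + fracP γ)) x) :
    HasSum (fun n : ℤ => if 0 < (n : ℝ) + γ then F (n + γ) else 0) x := by
  have hinj : Function.Injective fun m : ℕ => (posEquiv γ m).1 :=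
    Subtype.val_injective.comp (posEquiv γ).injective
  refine (hinj.hasSum_iff fun n hn => if_neg fun h0 => hn ?_).1 ?_
  · refine ⟨(posEquiv γ).symm ⟨n, by linarith⟩, ?_⟩
    simp
  · refine Eq.subst (motive := fun f => HasSum f x) (funext fun m => ?_) h
    rw [Function.comp, add_comm _ γ, add_posEquiv, if_pos]
    have := fracP_pos γ
    positivity

/-- A sum over the nonzero elements of `ℤ + γ`, split according to the sign. -/
theorem hasSum_lattice {F : ℝ → ℂ} {γ : ℝ} {x y : ℂ}
    (hpos : HasSum (fun m : ℕ => F (m + fracP γ)) x)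
    (hneg : HasSum (fun m : ℕ => F (-(m + fracP (-γ)))) y) :
    HasSum (fun n : ℤ => if (n : ℝ) + γ = 0 then 0 else F (n + γ)) (x + y) := by
  have h1 := hasSum_lattice_pos hpos
  have h2 := (Equiv.neg ℤ).hasSum_iff.2 (hasSum_lattice_pos (F := fun x => F (-x)) hneg)
  refine Eq.subst (motive := fun f => HasSum f (x + y)) (funext fun n => ?_) (h1.add h2)
  simp only [Function.comp, Equiv.neg_apply]
  have h3 : -(((-n : ℤ) : ℝ) + -γ) = n + γ := by push_cast; ring
  have h4 : 0 < (((-n : ℤ) : ℝ) + -γ) ↔ (n : ℝ) + γ < 0 := by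
    rw [← h3]; constructor <;> intro h <;> linarith
  rw [h3]
  simp only [h4]
  rcases lt_trichotomy ((n : ℝ) + γ) 0 with h | h | h
  · rw [if_neg h.not_gt, if_pos h, if_neg h.ne, zero_add]
  · rw [if_neg h.not_gt, if_neg h.not_lt, if_pos h, zero_add]
  · rw [if_pos h, if_neg h.not_gt, if_neg h.ne', add_zero]

/-- The general term of the weighted Lambert series. -/
def lambertTerm (g : ℝ → ℂ) (a κ : ℝ) (t : ℂ) (p : ℕ × ℕ) : ℂ :=
  ee ((((p.1 : ℝ) + 1) * κ : ℝ) : ℂ) * g ((p.2 : ℝ) + a) *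
    Complex.exp (-2 * (π : ℂ) * t * (((p.1 : ℝ) + 1 : ℝ) : ℂ) * (((p.2 : ℝ) + a : ℝ) : ℂ))

/-- The weighted Lambert series `∑ e((m+1)κ) g(n+a) e^{-2πt(m+1)(n+a)}` over `m, n ≥ 0`. -/
def lambertSum (g : ℝ → ℂ) (a κ : ℝ) (t : ℂ) : ℂ := ∑' p : ℕ × ℕ, lambertTerm g a κ t p

theorem norm_ee_ofReal (x : ℝ) : ‖ee (x : ℂ)‖ = 1 := by simp [norm_ee]

theorem norm_lambertTerm (g : ℝ → ℂ) (a κ : ℝ) (t : ℂ) (p : ℕ × ℕ) :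
    ‖lambertTerm g a κ t p‖ =
      ‖g (p.2 + a)‖ * Real.exp (-(2 * π * t.re * (p.1 + 1) * (p.2 + a))) := by
  rw [lambertTerm, norm_mul, norm_mul, norm_ee_ofReal, one_mul, Complex.norm_exp]
  congr 2
  rw [show -2 * (π : ℂ) * t * (((p.1 : ℝ) + 1 : ℝ) : ℂ) * (((p.2 : ℝ) + a : ℝ) : ℂ) =
    ((-2 * π * (p.1 + 1) * (p.2 + a) : ℝ) : ℂ) * t by push_cast; ring, Complex.re_ofReal_mul]
  ring

theorem summable_exp_lambert {a ρ β : ℝ} (ha : 0 < a) (hβ : 0 ≤ β) (hρ : β < ρ) :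
    Summable fun p : ℕ × ℕ =>
      Real.exp (β * (p.2 + a)) * Real.exp (-(ρ * (p.1 + 1) * (p.2 + a))) := by
  have hgeom : ∀ {x : ℝ}, 0 < x → Summable fun n : ℕ => Real.exp (-x) ^ n := fun hx =>
    summable_geometric_of_lt_one (Real.exp_pos _).le (Real.exp_lt_one_iff.2 (neg_lt_zero.2 hx))
  have hρ0 : 0 < ρ := hβ.trans_lt hρ
  have h := (hgeom (mul_pos hρ0 ha)).mul_of_nonneg (hgeom (sub_pos.2 hρ))
    (fun n => by positivity) (fun n => by positivity)
  refine h.of_nonneg_of_le (fun p => by positivity) fun p => ?_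
  rw [← Real.exp_add, ← Real.exp_nat_mul, ← Real.exp_nat_mul, ← Real.exp_add, Real.exp_le_exp]
  have h1 : (0 : ℝ) ≤ p.1 := p.1.cast_nonneg
  have h2 : (0 : ℝ) ≤ p.2 := p.2.cast_nonneg
  have h3 : 0 ≤ ρ * p.1 * p.2 := by positivity
  have h4 : 0 ≤ (ρ - β) * a := mul_nonneg (sub_pos.2 hρ).le ha.le
  nlinarith

theorem summable_lambertTerm {g : ℝ → ℂ} {a : ℝ} (ha : 0 < a) {κ B β : ℝ} {t : ℂ} (hβ : 0 ≤ β)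
    (ht : β < 2 * π * t.re) (hg : ∀ n : ℕ, ‖g (n + a)‖ ≤ B * Real.exp (β * (n + a))) :
    Summable (lambertTerm g a κ t) := by
  refine .of_norm_bounded ((summable_exp_lambert ha hβ ht).mul_left B) fun p => ?_
  rw [norm_lambertTerm, ← mul_assoc]
  gcongr
  exact hg p.2

theorem norm_ee_I_mul_lt_one {t : ℂ} (ht : 0 < t.re) {x : ℝ} (hx : 0 < x) (κ : ℝ) :
    ‖ee (I * t * (x : ℂ) + κ)‖ < 1 := by
  rw [norm_ee_add_ofReal, norm_ee, Real.exp_lt_one_iff]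
  have : (I * t * (x : ℂ)).im = t.re * x := by
    rw [mul_comm, Complex.im_ofReal_mul]; simp [mul_comm]
  rw [this]
  have : 0 < 2 * π * (t.re * x) := by positivity
  linarith

theorem hasSum_swap_lambertTerm {g : ℝ → ℂ} {a κ : ℝ} {t : ℂ} (ht : 0 < t.re) (ha : 0 < a)
    (hs : Summable (lambertTerm g a κ t)) :
    HasSum (fun n : ℕ => g (n + a) * ∑' m : ℕ, ee (I * t * ((n + a : ℝ) : ℂ) + κ) ^ (m + 1))
      (lambertSum g a κ t) := by
  have h1 : HasSum (fun q : ℕ × ℕ => lambertTerm g a κ t q.swap) (lambertSum g a κ t) :=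
    (Equiv.prodComm ℕ ℕ).hasSum_iff.2 hs.hasSum
  refine h1.prod_fiberwise fun n => ?_
  have hlt : ‖ee (I * t * ((n + a : ℝ) : ℂ) + κ)‖ < 1 :=
    norm_ee_I_mul_lt_one ht (by positivity) κ
  have h2 := ((summable_geometric_of_norm_lt_one hlt).comp_injective
    (add_left_injective 1)).hasSum.mul_left
    (g (n + a))
  refine Eq.subst (motive := fun f => HasSum f _) (funext fun m => ?_) h2
  simp only [Function.comp, lambertTerm, Prod.swap]
  rw [← ee_natCast_mul, mul_comm (ee _) (g _), mul_assoc (g _)]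
  congr 1
  simp only [ee]
  rw [← Complex.exp_add]
  congr 1
  push_cast
  linear_combination (2 * π * (m + 1) * t * (n + a)) * I_mul_I

theorem eeKer_eq_neg_one_sub_tsum {ζ : ℂ} (h : ‖ee ζ‖ < 1) :
    eeKer ζ = -1 - ∑' m : ℕ, ee ζ ^ (m + 1) := by
  have h1 : 1 - ee ζ ≠ 0 := sub_ne_zero.2 fun h0 => by rw [← h0, norm_one] at h; exact lt_irrefl _ h
  have h2 : ee ζ - 1 ≠ 0 := sub_ne_zero.2 (sub_ne_zero.1 h1).symm
  simp only [pow_succ']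
  rw [tsum_mul_left, tsum_geometric_of_norm_lt_one h, eeKer]
  field_simp
  ring

theorem eeKer_neg_eq_tsum {ζ : ℂ} (h : ‖ee ζ‖ < 1) : eeKer (-ζ) = ∑' m : ℕ, ee ζ ^ (m + 1) := by
  have h1 : 1 - ee ζ ≠ 0 := sub_ne_zero.2 fun h0 => by rw [← h0, norm_one] at h; exact lt_irrefl _ h
  have h3 : ee ζ ≠ 0 := Complex.exp_ne_zero _
  simp only [pow_succ']
  rw [tsum_mul_left, tsum_geometric_of_norm_lt_one h, eeKer, ee_neg]
  rw [inv_eq_iff_eq_inv, mul_inv, inv_inv]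
  field_simp

/-- The sum of `g(x) / (e(itx+κ) - 1)` over the nonzero `x ∈ ℤ + γ` in terms of Lambert series. -/
theorem hasSum_lattice_mul_eeKer {g : ℝ → ℂ} {γ κ B β : ℝ} {t x : ℂ} (ht : 0 < t.re) (hβ : 0 ≤ β)
    (hβt : β < 2 * π * t.re)
    (hg : ∀ n : ℕ, ‖g (n + fracP γ)‖ ≤ B * Real.exp (β * (n + fracP γ)))
    (hg' : ∀ n : ℕ, ‖g (-(n + fracP (-γ)))‖ ≤ B * Real.exp (β * (n + fracP (-γ))))
    (hx : HasSum (fun n : ℕ => g (n + fracP γ)) x) :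
    HasSum (fun n : ℤ => if (n : ℝ) + γ = 0 then 0 else
        g (n + γ) * eeKer (I * t * (((n : ℝ) + γ : ℝ) : ℂ) + κ))
      (-x - lambertSum g (fracP γ) κ t + lambertSum (fun x => g (-x)) (fracP (-γ)) (-κ) t) := by
  refine hasSum_lattice (F := fun x => g x * eeKer (I * t * (x : ℂ) + κ)) ?_ ?_
  · have h1 := hasSum_swap_lambertTerm ht (fracP_pos γ)
      (summable_lambertTerm (κ := κ) (fracP_pos γ) hβ hβt hg)
    refine Eq.subst (motive := fun f => HasSum f _) (funext fun n => ?_) (hx.neg.sub h1)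
    rw [eeKer_eq_neg_one_sub_tsum]
    · ring
    · exact norm_ee_I_mul_lt_one ht (by have := fracP_pos γ; positivity) κ
  · have h1 := hasSum_swap_lambertTerm (g := fun x => g (-x)) ht (fracP_pos (-γ))
      (summable_lambertTerm (κ := -κ) (fracP_pos (-γ)) hβ hβt hg')
    refine Eq.subst (motive := fun f => HasSum f _) (funext fun n => ?_) h1
    rw [← eeKer_neg_eq_tsum]
    · congr 2
      push_cast
      ring
    · exact norm_ee_I_mul_lt_one ht (by have := fracP_pos (-γ); positivity) (-κ)

theorem Scal_eq_lambertSum {r : ℂ} {γ κ : ℝ} {t : ℂ}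
    (hs : Summable (lambertTerm (fun x => (x : ℂ) ^ (-r)) (fracP γ) κ t)) :
    Scal r 0 γ κ 0 t = lambertSum (fun x => (x : ℂ) ^ (-r)) (fracP γ) κ t := by
  rw [lambertSum, hs.tsum_prod, Scal, ← (posEquiv 0).tsum_eq]
  refine tsum_congr fun m => ?_
  rw [← (posEquiv γ).tsum_eq]
  refine tsum_congr fun n => ?_
  rw [add_posEquiv, add_posEquiv, fracP_zero, mul_zero, add_zero, lambertTerm]

/-- The combination of a Hurwitz zeta value and two Lambert series which satisfies the
transformation law under `t ↦ 1 / t`. -/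
def zetaScal (k : ℤ) (γ κ : ℝ) (t : ℂ) : ℂ :=
  HurwitzZeta.hurwitzZeta (γ : UnitAddCircle) (k : ℂ) + Scal (k : ℂ) 0 γ κ 0 t +
    (-1 : ℂ) ^ (k - 1) * Scal (k : ℂ) 0 (-γ) (-κ) 0 t

theorem coe_fracP (γ : ℝ) : (fracP γ : UnitAddCircle) = (γ : UnitAddCircle) := by
  rw [fracP_eq, show γ + (⌊-γ⌋ : ℝ) + 1 = γ + ((⌊-γ⌋ + 1 : ℤ) : ℝ) by push_cast; ring,
    AddCircle.coe_add]
  have : (((⌊-γ⌋ + 1 : ℤ) : ℝ) : UnitAddCircle) = 0 :=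
    (AddCircle.coe_eq_zero_iff 1).2 ⟨⌊-γ⌋ + 1, by simp⟩
  rw [this, add_zero]

theorem Scal_intCast {k : ℤ} {γ κ : ℝ} {t : ℂ}
    (hs : Summable (lambertTerm (fun x => (x : ℂ) ^ (-k)) (fracP γ) κ t)) :
    Scal (k : ℂ) 0 γ κ 0 t = lambertSum (fun x => (x : ℂ) ^ (-k)) (fracP γ) κ t := by
  have h : (fun x : ℝ => (x : ℂ) ^ (-(k : ℂ))) = fun x : ℝ => (x : ℂ) ^ (-k) := by
    funext x
    rw [← Int.cast_neg, Complex.cpow_intCast]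
  rw [Scal_eq_lambertSum (by rwa [h]), h]

theorem lambertSum_const_mul (c : ℂ) (g : ℝ → ℂ) (a κ : ℝ) (t : ℂ) :
    lambertSum (fun x => c * g x) a κ t = c * lambertSum g a κ t := by
  rw [lambertSum, lambertSum, ← tsum_mul_left]
  refine tsum_congr fun p => ?_
  rw [lambertTerm, lambertTerm]
  ring

theorem norm_zpow_neg_le {a x : ℝ} (ha : 0 < a) (h : a ≤ |x|) (K : ℕ) :
    ‖(x : ℂ) ^ (-(K : ℤ))‖ ≤ (a ^ K)⁻¹ := by
  rw [zpow_neg, zpow_natCast, norm_inv, norm_pow, Complex.norm_real, Real.norm_eq_abs]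
  gcongr

theorem hasSum_lattice_zpow_mul_eeKer {K : ℕ} (hK : 2 ≤ K) {γ κ : ℝ} {t : ℂ} (ht : 0 < t.re)
    (c : ℂ) :
    HasSum (fun n : ℤ => if (n : ℝ) + γ = 0 then 0 else
        (c * (((n : ℝ) + γ : ℝ) : ℂ)) ^ (-(K : ℤ)) *
          eeKer (I * t * (((n : ℝ) + γ : ℝ) : ℂ) + κ))
      (-(c ^ (-(K : ℤ)) * zetaScal K γ κ t)) := by
  have hp := fracP_pos γ
  have hp' := fracP_pos (-γ)
  have hm : 0 < min (fracP γ) (fracP (-γ)) := lt_min hp hp'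
  have hB : ∀ n : ℕ, ‖((((n : ℝ) + fracP γ : ℝ)) : ℂ) ^ (-(K : ℤ))‖ ≤
      ((min (fracP γ) (fracP (-γ))) ^ K)⁻¹ * Real.exp (0 * (n + fracP γ)) := fun n => by
    rw [zero_mul, Real.exp_zero, mul_one]
    refine norm_zpow_neg_le hm ?_ K
    rw [abs_of_pos (by positivity)]
    exact (min_le_left _ _).trans (le_add_of_nonneg_left n.cast_nonneg)
  have hB1 : ∀ n : ℕ, ‖((((n : ℝ) + fracP (-γ) : ℝ)) : ℂ) ^ (-(K : ℤ))‖ ≤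
      ((min (fracP γ) (fracP (-γ))) ^ K)⁻¹ * Real.exp (0 * (n + fracP (-γ))) := fun n => by
    rw [zero_mul, Real.exp_zero, mul_one]
    refine norm_zpow_neg_le hm ?_ K
    rw [abs_of_pos (by positivity)]
    exact (min_le_right _ _).trans (le_add_of_nonneg_left n.cast_nonneg)
  have hB' : ∀ n : ℕ, ‖((-((n : ℝ) + fracP (-γ)) : ℝ) : ℂ) ^ (-(K : ℤ))‖ ≤
      ((min (fracP γ) (fracP (-γ))) ^ K)⁻¹ * Real.exp (0 * (n + fracP (-γ))) := fun n => by
    refine le_trans (le_of_eq ?_) (hB1 n)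
    rw [zpow_neg, zpow_neg, zpow_natCast, zpow_natCast, norm_inv, norm_inv, norm_pow, norm_pow,
      Complex.ofReal_neg, norm_neg]
  have ht' : 0 < 2 * π * t.re := by positivity
  have hz : HasSum (fun n : ℕ => ((((n : ℝ) + fracP γ : ℝ)) : ℂ) ^ (-(K : ℤ)))
      (HurwitzZeta.hurwitzZeta (γ : UnitAddCircle) (K : ℂ)) := by
    have h := HurwitzZeta.hasSum_hurwitzZeta_of_one_lt_re (a := fracP γ) ⟨hp.le, fracP_le_one γ⟩
      (s := (K : ℂ)) (by
        rw [Complex.natCast_re]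
        have : (2 : ℝ) ≤ K := by exact_mod_cast hK
        linarith)
    rw [coe_fracP] at h
    refine Eq.subst (motive := fun f => HasSum f _) (funext fun n => ?_) h
    rw [zpow_neg, zpow_natCast, Complex.cpow_natCast, one_div]
    push_cast
    rfl
  have h := (hasSum_lattice_mul_eeKer (g := fun x => (x : ℂ) ^ (-(K : ℤ))) (κ := κ) ht le_rfl ht'
    hB hB' hz).mul_left (c ^ (-(K : ℤ)))
  have hneg : (fun x : ℝ => ((-x : ℝ) : ℂ) ^ (-(K : ℤ))) =
      fun x : ℝ => (-1) ^ K * (x : ℂ) ^ (-(K : ℤ)) := by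
    funext x
    rw [Complex.ofReal_neg, neg_eq_neg_one_mul, mul_zpow]
    congr 1
    rw [zpow_neg, zpow_natCast, ← inv_pow, inv_neg_one]
  have hval : c ^ (-(K : ℤ)) *
      (-HurwitzZeta.hurwitzZeta (γ : UnitAddCircle) (K : ℂ) -
          lambertSum (fun x => (x : ℂ) ^ (-(K : ℤ))) (fracP γ) κ t +
        lambertSum (fun x : ℝ => ((-x : ℝ) : ℂ) ^ (-(K : ℤ))) (fracP (-γ)) (-κ) t) =
      -(c ^ (-(K : ℤ)) * zetaScal K γ κ t) := by
    rw [hneg, lambertSum_const_mul, zetaScal,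
      Scal_intCast (summable_lambertTerm (fracP_pos γ) le_rfl ht' hB),
      Scal_intCast (summable_lambertTerm (fracP_pos (-γ)) le_rfl ht' hB1),
      zpow_sub_one₀ (by norm_num), inv_neg_one, zpow_natCast, Int.cast_natCast]
    ring
  rw [← hval]
  refine Eq.subst (motive := fun f => HasSum f _) (funext fun n => ?_) h
  rw [mul_ite, mul_zero, ← mul_assoc, mul_zpow]

open Filter Topology in
theorem tendsto_decay_zpow {K : ℕ} (hK : 2 ≤ K) (σ : ℂ) :
    Tendsto (fun z : ℂ => ‖z ^ (-(K : ℤ))‖ * ‖z‖ / (max 1 ‖ee z‖ * max 1 ‖ee (σ * z)‖))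
      (Bornology.cobounded ℂ) (𝓝 0) := by
  have h0 : Tendsto (fun z : ℂ => ‖z‖⁻¹) (Bornology.cobounded ℂ) (𝓝 0) :=
    tendsto_inv_atTop_zero.comp tendsto_norm_cobounded_atTop
  refine squeeze_zero' (Eventually.of_forall fun z => by positivity) ?_ h0
  filter_upwards [tendsto_norm_cobounded_atTop.eventually_ge_atTop 1] with z hz
  refine (div_le_self (by positivity) ?_).trans ?_
  · exact one_le_mul_of_one_le_of_one_le (le_max_left _ _) (le_max_left _ _)
  · have hz0 : 0 < ‖z‖ := by linarith
    obtain ⟨L, rfl⟩ := Nat.exists_eq_add_of_le hK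
    rw [zpow_neg, zpow_natCast, norm_inv, norm_pow, pow_add, mul_inv,
      show (‖z‖ ^ 2)⁻¹ * (‖z‖ ^ L)⁻¹ * ‖z‖ = ‖z‖⁻¹ * (‖z‖ ^ L)⁻¹ by field_simp]
    exact mul_le_of_le_one_right (by positivity) (inv_le_one_of_one_le₀ (one_le_pow₀ hz))

theorem neg_ofReal_div_I_mul (t : ℂ) (x : ℝ) :
    -(x : ℂ) / (I * t) = I * (1 / t) * (x : ℂ) := by
  rw [div_eq_mul_inv, mul_inv, Complex.inv_I]
  ring

open Filter Topology in
/-- The transformation law of `zetaScal` at integers `K ≥ 2`. -/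
theorem zetaScal_sub_zetaScal_of_two_le {K : ℕ} (hK : 2 ≤ K) {μ ν : ℝ} {t : ℂ} (ht : 0 < t.re)
    {a b : ℕ → ℂ}
    (ha : ∀ᶠ z in 𝓝[≠] (0 : ℂ), HasSum (fun j => a j * z ^ j) (z * eeKer (z + μ)))
    (hb : ∀ᶠ z in 𝓝[≠] (0 : ℂ), HasSum (fun j => b j * z ^ j) (z * eeKer (I * t * z + ν))) :
    zetaScal K (-μ) ν t - (-I * t) ^ ((K : ℤ) - 1) * zetaScal K ν μ (1 / t) =
      2 * π * I * cauchyCoeff a b (K + 1) := by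
  have ht0 : t ≠ 0 := fun h => by simp [h] at ht
  have hσ : 0 < (I * t).im := by simpa using ht
  have ht1 : 0 < (1 / t).re := by
    rw [one_div, Complex.inv_re]
    exact div_pos ht (Complex.normSq_pos.2 ht0)
  have h1 := hasSum_lattice_zpow_mul_eeKer hK (γ := -μ) (κ := ν) ht 1
  have h2 := hasSum_lattice_zpow_mul_eeKer hK (γ := ν) (κ := μ) ht1 (I * (1 / t))
  simp only [one_mul, one_zpow] at h1
  simp only [← neg_ofReal_div_I_mul] at h2
  have h3 := sum_residues_eq_zero hσ (g := fun z => z ^ (-(K : ℤ))) (M := K + 2)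
    (d := cauchyCoeff a b) (fun z hz => (differentiableAt_zpow.2 (Or.inl hz))) (by omega) ?_
    (tendsto_decay_zpow hK _) h1 h2
  · have hc : (I * t)⁻¹ * (I * (1 / t)) ^ (-(K : ℤ)) = -(-I * t) ^ ((K : ℤ) - 1) := by
      have h4 : (I * (1 / t)) = (-I * t)⁻¹ := by
        rw [mul_inv, inv_neg, Complex.inv_I, neg_neg, one_div]
      have h5 : -I * t ≠ 0 := mul_ne_zero (neg_ne_zero.2 I_ne_zero) ht0
      rw [h4, inv_zpow, zpow_neg, inv_inv, zpow_sub_one₀ h5, neg_mul I t, inv_neg]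
      ring
    rw [show K + 2 - 1 = K + 1 from rfl] at h3
    linear_combination (-1) * h3 - zetaScal K ν μ (1 / t) * hc
  · filter_upwards [ha, hb, self_mem_nhdsWithin] with z hza hzb (hz : z ≠ 0)
    have h4 := hasSum_cauchyCoeff hza hzb
    rw [show z ^ (K + 2) * (z ^ (-(K : ℤ)) * eeKer (z + μ) * eeKer (I * t * z + ν)) =
      z * eeKer (z + μ) * (z * eeKer (I * t * z + ν)) by
        rw [zpow_neg, zpow_natCast]; field_simp; ring]
    exact h4

theorem hasDerivAt_ofReal_cpow_neg {x : ℝ} (hx : 0 < x) (s : ℂ) :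
    HasDerivAt (fun u : ℝ => (u : ℂ) ^ (-s)) (-s * (x : ℂ) ^ (-(s + 1))) x := by
  have h := ((hasDerivAt_id (x : ℂ)).cpow_const (c := -s)
    (Or.inl (by simpa using hx))).comp_ofReal
  simpa [neg_add, sub_eq_add_neg, add_comm] using h

/-- Mean value estimate for the difference of two powers with positive bases. -/
theorem norm_cpow_neg_sub_cpow_neg_le {x y : ℝ} (hx : 0 < x) (hxy : x ≤ y) {s : ℂ}
    (hs : 0 ≤ s.re + 1) :
    ‖(y : ℂ) ^ (-s) - (x : ℂ) ^ (-s)‖ ≤ ‖s‖ * x ^ (-(s.re + 1)) * (y - x) := by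
  have h := (convex_Icc x y).norm_image_sub_le_of_norm_hasDerivWithin_le
    (f := fun u : ℝ => (u : ℂ) ^ (-s)) (f' := fun u : ℝ => -s * (u : ℂ) ^ (-(s + 1)))
    (C := ‖s‖ * x ^ (-(s.re + 1)))
    (fun u hu => (hasDerivAt_ofReal_cpow_neg (hx.trans_le hu.1) s).hasDerivWithinAt)
    (fun u hu => ?_) (Set.left_mem_Icc.2 hxy) (Set.right_mem_Icc.2 hxy)
  · rwa [Real.norm_of_nonneg (sub_nonneg.2 hxy)] at h
  · rw [norm_mul, norm_neg, norm_cpow_eq_rpow_re_of_pos (hx.trans_le hu.1)]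
    refine mul_le_mul_of_nonneg_left ?_ (norm_nonneg _)
    simpa using Real.rpow_le_rpow_of_nonpos hx hu.1 (neg_nonpos.2 hs)

/-- Error of the linear interpolation of `u ↦ u ^ (-s)` from the values at `y` and `y + 1`. -/
theorem norm_cpow_neg_interpolation_le {x y : ℝ} (hx : 0 < x) (hxy : x ≤ y) {s : ℂ}
    (hs : 0 ≤ s.re + 2) :
    ‖(x : ℂ) ^ (-s) - (y : ℂ) ^ (-s) -
        ((y - x : ℝ) : ℂ) * ((y : ℂ) ^ (-s) - ((y + 1 : ℝ) : ℂ) ^ (-s))‖ ≤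
      ‖s‖ * (‖s + 1‖ * x ^ (-(s.re + 2)) * (y + 1 - x)) * (y - x) := by
  set C : ℂ := (y : ℂ) ^ (-s) - ((y + 1 : ℝ) : ℂ) ^ (-s) with hC
  have hbound : ∀ u ∈ Set.Icc x y, ‖-s * (u : ℂ) ^ (-(s + 1)) + C‖ ≤
      ‖s‖ * (‖s + 1‖ * x ^ (-(s.re + 2)) * (y + 1 - x)) := by
    intro u hu
    have hu0 := hx.trans_le hu.1
    have h := (convex_Icc y (y + 1)).norm_image_sub_le_of_norm_hasDerivWithin_le
      (f := fun v : ℝ => (v : ℂ) ^ (-s) + (v : ℂ) * (s * (u : ℂ) ^ (-(s + 1))))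
      (f' := fun v : ℝ => -s * (v : ℂ) ^ (-(s + 1)) + 1 * (s * (u : ℂ) ^ (-(s + 1))))
      (C := ‖s‖ * (‖s + 1‖ * x ^ (-(s.re + 2)) * (y + 1 - x)))
      (fun v hv => ((hasDerivAt_ofReal_cpow_neg (hu0.trans_le (hu.2.trans hv.1)) s).add
        ((hasDerivAt_id (v : ℂ)).comp_ofReal.mul_const _)).hasDerivWithinAt)
      (fun v hv => ?_) (Set.left_mem_Icc.2 (by linarith)) (Set.right_mem_Icc.2 (by linarith))
    · rw [← norm_neg]
      rw [add_sub_cancel_left, norm_one, mul_one] at h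
      refine le_of_eq_of_le (congrArg _ ?_) h
      rw [hC]; push_cast; ring
    · have h1 := norm_cpow_neg_sub_cpow_neg_le hu0 (hu.2.trans hv.1) (s := s + 1)
        (by simp; linarith)
      have h2 : (s + 1).re + 1 = s.re + 2 := by simp; ring
      rw [h2] at h1
      rw [show -s * (v : ℂ) ^ (-(s + 1)) + 1 * (s * (u : ℂ) ^ (-(s + 1))) =
        -s * ((v : ℂ) ^ (-(s + 1)) - (u : ℂ) ^ (-(s + 1))) by ring, norm_mul, norm_neg]
      refine mul_le_mul_of_nonneg_left (h1.trans ?_) (norm_nonneg _)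
      have h3 : u ^ (-(s.re + 2)) ≤ x ^ (-(s.re + 2)) :=
        Real.rpow_le_rpow_of_nonpos hx hu.1 (neg_nonpos.2 hs)
      have h4 : 0 ≤ v - u := by linarith [hu.2, hv.1]
      have h5 : v - u ≤ y + 1 - x := by linarith [hu.1, hv.2]
      gcongr
  have h := (convex_Icc x y).norm_image_sub_le_of_norm_hasDerivWithin_le
    (f := fun u : ℝ => (u : ℂ) ^ (-s) + (u : ℂ) * C)
    (f' := fun u : ℝ => -s * (u : ℂ) ^ (-(s + 1)) + 1 * C)
    (fun u hu => ((hasDerivAt_ofReal_cpow_neg (hx.trans_le hu.1) s).add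
      ((hasDerivAt_id (u : ℂ)).comp_ofReal.mul_const _)).hasDerivWithinAt)
    (fun u hu => by rw [one_mul]; exact hbound u hu)
    (Set.left_mem_Icc.2 hxy) (Set.right_mem_Icc.2 hxy)
  rw [Real.norm_of_nonneg (sub_nonneg.2 hxy), ← norm_neg] at h
  refine le_of_eq_of_le (congrArg _ ?_) h
  push_cast; ring

/-- The summand of a series for `ζ(s, a) - ζ(s) - (1 - a)` that converges for `-1 < re s`. -/
def hurwitzTail (a : ℝ) (n : ℕ) (s : ℂ) : ℂ :=
  ((n + a : ℝ) : ℂ) ^ (-s) - ((n + 1 : ℝ) : ℂ) ^ (-s) -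
    ((1 - a : ℝ) : ℂ) * (((n + 1 : ℝ) : ℂ) ^ (-s) - ((n + 1 + 1 : ℝ) : ℂ) ^ (-s))

theorem norm_hurwitzTail_le {a : ℝ} (ha : 0 < a) (ha1 : a ≤ 1) (n : ℕ) {s : ℂ}
    (hs : s ∈ Metric.ball (1 : ℂ) (3 / 2)) :
    ‖hurwitzTail a n s‖ ≤ 20 * a ^ (-(9 / 2) : ℝ) * ((n + 1 : ℕ) : ℝ) ^ (-(3 / 2) : ℝ) := by
  rw [mem_ball_iff_norm] at hs
  have hre := (abs_re_le_norm (s - 1)).trans_lt hs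
  rw [abs_lt] at hre
  simp only [sub_re, one_re] at hre
  have hx : 0 < (n : ℝ) + a := by positivity
  have h := norm_cpow_neg_interpolation_le hx (y := n + 1) (by linarith) (s := s) (by linarith)
  rw [show (n : ℝ) + 1 - (n + a) = 1 - a by ring,
    show (n : ℝ) + 1 + 1 - (n + a) = 2 - a by ring] at h
  refine h.trans ?_
  have h1 : ‖s‖ ≤ 5 / 2 := by
    have := norm_add_le (s - 1) 1
    rw [sub_add_cancel, norm_one] at this
    linarith
  have h2 : ‖s + 1‖ ≤ 7 / 2 := by
    have := norm_add_le s 1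
    rw [norm_one] at this
    linarith
  have h3 : ((n : ℝ) + a) ^ (-(s.re + 2)) ≤
      a ^ (-(9 / 2) : ℝ) * ((n + 1 : ℕ) : ℝ) ^ (-(3 / 2) : ℝ) := by
    have h4 : a * ((n + 1 : ℕ) : ℝ) ≤ n + a := by
      push_cast
      nlinarith [Nat.cast_nonneg (α := ℝ) n]
    calc ((n : ℝ) + a) ^ (-(s.re + 2)) ≤ (a * ((n + 1 : ℕ) : ℝ)) ^ (-(s.re + 2)) :=
          Real.rpow_le_rpow_of_nonpos (by positivity) h4 (by linarith)
      _ = a ^ (-(s.re + 2)) * ((n + 1 : ℕ) : ℝ) ^ (-(s.re + 2)) :=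
          Real.mul_rpow ha.le (by positivity)
      _ ≤ _ := by
          refine mul_le_mul (Real.rpow_le_rpow_of_exponent_ge ha ha1 (by linarith))
            (Real.rpow_le_rpow_of_exponent_le ?_ (by linarith)) (by positivity) (by positivity)
          push_cast
          linarith [Nat.cast_nonneg (α := ℝ) n]
  set R := a ^ (-(9 / 2) : ℝ) * ((n + 1 : ℕ) : ℝ) ^ (-(3 / 2) : ℝ) with hR
  have hR0 : 0 ≤ R := by positivity
  calc ‖s‖ * (‖s + 1‖ * ((n : ℝ) + a) ^ (-(s.re + 2)) * (2 - a)) * (1 - a)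
      ≤ 5 / 2 * (7 / 2 * R * 2) * 1 := by
        have : 0 ≤ 2 - a := by linarith
        have : 0 ≤ 1 - a := by linarith
        gcongr <;> linarith
    _ ≤ 20 * a ^ (-(9 / 2) : ℝ) * ((n + 1 : ℕ) : ℝ) ^ (-(3 / 2) : ℝ) := by
        rw [mul_assoc 20, ← hR]; linarith

theorem differentiable_hurwitzTail {a : ℝ} (ha : 0 < a) (n : ℕ) :
    Differentiable ℂ (hurwitzTail a n) := by
  have h : ∀ x : ℝ, 0 < x → Differentiable ℂ fun s : ℂ => (x : ℂ) ^ (-s) := fun x hx s =>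
    (differentiableAt_id.neg).const_cpow (Or.inl (by exact_mod_cast hx.ne'))
  unfold hurwitzTail
  exact ((h _ (by positivity)).sub (h _ (by positivity))).sub
    (((h _ (by positivity)).sub (h _ (by positivity))).const_mul _)

theorem hasSum_hurwitzTail {a : ℝ} (ha : 0 < a) (ha1 : a ≤ 1) {s : ℂ} (hs : 1 < s.re) :
    HasSum (fun n => hurwitzTail a n s)
      (HurwitzZeta.hurwitzZeta (a : UnitAddCircle) s - HurwitzZeta.hurwitzZeta 0 s -
        ((1 - a : ℝ) : ℂ)) := by
  have h1 := HurwitzZeta.hasSum_hurwitzZeta_of_one_lt_re (a := a) ⟨ha.le, ha1⟩ hs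
  have h2 := HurwitzZeta.hasSum_hurwitzZeta_of_one_lt_re (a := 1) ⟨zero_le_one, le_rfl⟩ hs
  have h3 := (hasSum_nat_add_iff' 1).2 h2
  rw [AddCircle.coe_period] at h2 h3
  have h4 := (h1.sub h2).sub ((h2.sub h3).mul_left ((1 - a : ℝ) : ℂ))
  have hval : ∀ x : ℂ, x - (x - ∑ i ∈ Finset.range 1, 1 / ((i : ℂ) + ((1 : ℝ) : ℂ)) ^ s) = 1 := by
    simp
  rw [hval, mul_one] at h4
  refine Eq.subst (motive := fun f => HasSum f _) (funext fun n => ?_) h4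
  simp only [hurwitzTail, one_div, cpow_neg]
  push_cast
  rfl

open Filter Topology in
/-- The value of the Hurwitz zeta function at `0`. -/
theorem hurwitzZeta_apply_zero {a : ℝ} (ha : 0 < a) (ha1 : a ≤ 1) :
    HurwitzZeta.hurwitzZeta (a : UnitAddCircle) 0 = 1 / 2 - a := by
  have hsum : Summable fun n : ℕ =>
      20 * a ^ (-(9 / 2) : ℝ) * ((n + 1 : ℕ) : ℝ) ^ (-(3 / 2) : ℝ) :=
    (((summable_nat_add_iff 1).2 (Real.summable_nat_rpow.2 (by norm_num))).mul_left _)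
  have hd : DifferentiableOn ℂ (fun s => ∑' n, hurwitzTail a n s) (Metric.ball 1 (3 / 2)) :=
    differentiableOn_tsum_of_summable_norm hsum
      (fun n => (differentiable_hurwitzTail ha n).differentiableOn) Metric.isOpen_ball
      (fun n s hs => norm_hurwitzTail_le ha ha1 n hs)
  have hd' : Differentiable ℂ fun s =>
      HurwitzZeta.hurwitzZeta (a : UnitAddCircle) s - HurwitzZeta.hurwitzZeta 0 s -
        ((1 - a : ℝ) : ℂ) :=
    (HurwitzZeta.differentiable_hurwitzZeta_sub_hurwitzZeta _ _).sub_const _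
  have heq := (hd.analyticOnNhd Metric.isOpen_ball).eqOn_of_preconnected_of_eventuallyEq
    (hd'.differentiableOn.analyticOnNhd Metric.isOpen_ball)
    (convex_ball (1 : ℂ) (3 / 2)).isPreconnected (z₀ := 2)
    (by rw [mem_ball_iff_norm]; norm_num)
    (by
      filter_upwards [continuous_re.continuousAt.eventually (lt_mem_nhds (by norm_num :
        (1 : ℝ) < (2 : ℂ).re))] with s hs
      exact (hasSum_hurwitzTail ha ha1 hs).tsum_eq)
  have h0 := heq (x := 0) (by rw [mem_ball_iff_norm]; norm_num)
  simp only [hurwitzTail, neg_zero, cpow_zero, sub_self, mul_zero, tsum_zero,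
    HurwitzZeta.hurwitzZeta_zero, riemannZeta_zero] at h0
  push_cast at h0
  linear_combination -h0

/-- Values of the Hurwitz zeta function at non-positive integers. -/
theorem hurwitzZeta_neg_natCast {a : ℝ} (ha : 0 < a) (ha1 : a ≤ 1) (n : ℕ) :
    HurwitzZeta.hurwitzZeta (a : UnitAddCircle) (-(n : ℂ)) =
      -1 / (n + 1) * Polynomial.aeval (a : ℂ) (Polynomial.bernoulli (n + 1)) := by
  rcases eq_or_ne n 0 with rfl | hn
  · rw [Nat.cast_zero, neg_zero, hurwitzZeta_apply_zero ha ha1]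
    simp [Polynomial.bernoulli_one]
  · rw [HurwitzZeta.hurwitzZeta_neg_nat hn ⟨ha.le, ha1⟩, Polynomial.eval_map_algebraMap]

open Filter Topology in
theorem hasFPowerSeriesAt_tsum_of_summable {c : ℕ → ℂ} {z₀ : ℂ} (hz₀ : z₀ ≠ 0)
    (hc : Summable fun n => c n * z₀ ^ n) :
    HasFPowerSeriesAt (fun z => ∑' n, c n * z ^ n) (FormalMultilinearSeries.ofScalars ℂ c) 0 := by
  rw [hasFPowerSeriesAt_iff]
  filter_upwards [Metric.ball_mem_nhds (0 : ℂ) (norm_pos_iff.2 hz₀)] with z hz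
  rw [mem_ball_zero_iff] at hz
  simp only [FormalMultilinearSeries.coeff_ofScalars, zero_add, smul_eq_mul, mul_comm (_ ^ _)]
  exact (summable_powerSeries_of_norm_lt hc.hasSum.tendsto_sum_nat.cauchySeq hz).hasSum

open Filter Topology in
/-- Two power series which agree at points accumulating at `0` have the same coefficients. -/
theorem eq_of_frequently_hasSum {a b : ℕ → ℂ}
    (h : ∃ᶠ z in 𝓝[≠] (0 : ℂ), ∃ y, HasSum (fun n => a n * z ^ n) y ∧
      HasSum (fun n => b n * z ^ n) y) : a = b := by
  have h' : ∃ᶠ z in 𝓝[≠] (0 : ℂ), HasSum (fun n => (a - b) n * z ^ n) 0 := by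
    refine h.mono ?_
    rintro z ⟨y, hy, hy'⟩
    simpa [sub_mul] using hy.sub hy'
  obtain ⟨z₀, hz₀, hne⟩ := (h'.and_eventually self_mem_nhdsWithin).exists
  have hp := hasFPowerSeriesAt_tsum_of_summable hne hz₀.summable
  have h0 := hp.analyticAt.frequently_zero_iff_eventually_zero.1
    (h'.mono fun z hz => hz.tsum_eq)
  have h1 := hp.eq_zero_of_eventually h0
  rw [FormalMultilinearSeries.ofScalars_series_eq_zero] at h1
  exact sub_eq_zero.1 h1

theorem coeff_mul_eq_cauchyCoeff (P Q : PowerSeries ℂ) (n : ℕ) :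
    PowerSeries.coeff n (P * Q) =
      cauchyCoeff (fun n => PowerSeries.coeff n P) (fun n => PowerSeries.coeff n Q) n := by
  rw [PowerSeries.coeff_mul, cauchyCoeff]

theorem hasSum_coeff_mul {P Q : PowerSeries ℂ} {x y z : ℂ}
    (hP : HasSum (fun n => PowerSeries.coeff n P * z ^ n) x)
    (hQ : HasSum (fun n => PowerSeries.coeff n Q * z ^ n) y) :
    HasSum (fun n => PowerSeries.coeff n (P * Q) * z ^ n) (x * y) := by
  simp only [coeff_mul_eq_cauchyCoeff]
  exact hasSum_cauchyCoeff hP hQ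

open Filter Topology in
/-- The analytic generating function of the Bernoulli polynomials. -/
theorem eventually_hasSum_bernoulli (a : ℂ) :
    ∀ᶠ z in 𝓝[≠] (0 : ℂ), HasSum (fun n : ℕ =>
      Polynomial.aeval a (Polynomial.bernoulli n) / (n.factorial : ℂ) * z ^ n)
      (z * Complex.exp (a * z) / (Complex.exp z - 1)) := by
  have hds : Differentiable ℂ (dslope Complex.exp 0) := by
    rw [← differentiableOn_univ, Complex.differentiableOn_dslope univ_mem]
    exact Complex.differentiable_exp.differentiableOn
  have hds0 : dslope Complex.exp 0 0 ≠ 0 := by simp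
  have han : AnalyticAt ℂ (fun z => (dslope Complex.exp 0 z)⁻¹ * Complex.exp (a * z)) 0 :=
    ((hds.analyticAt 0).inv hds0).mul
      (Differentiable.analyticAt (by fun_prop) 0)
  obtain ⟨p, hp⟩ := han
  have hF := (hasFPowerSeriesAt_iff.1 hp).filter_mono (nhdsWithin_le_nhds (s := {(0 : ℂ)}ᶜ))
  have hne : ∀ᶠ z in 𝓝[≠] (0 : ℂ), Complex.exp z - 1 ≠ 0 := by
    filter_upwards [((hds 0).continuousAt.eventually_ne hds0).filter_mono nhdsWithin_le_nhds,
      self_mem_nhdsWithin] with z hz hz0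
    rw [dslope_of_ne _ hz0, slope_def_field, Complex.exp_zero] at hz
    exact (div_ne_zero_iff.1 hz).1
  set P : PowerSeries ℂ := PowerSeries.mk p.coeff with hP
  set E : PowerSeries ℂ := PowerSeries.exp ℂ - 1 with hE
  set B : PowerSeries ℂ := PowerSeries.mk fun n =>
    Polynomial.aeval a ((1 / (n.factorial : ℚ) : ℚ) • Polynomial.bernoulli n) with hB
  have hBE : B * E = PowerSeries.X * PowerSeries.rescale a (PowerSeries.exp ℂ) :=
    Polynomial.bernoulli_generating_function a
  have hsP : ∀ᶠ z in 𝓝[≠] (0 : ℂ), HasSum (fun n => PowerSeries.coeff n P * z ^ n)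
      (z * Complex.exp (a * z) / (Complex.exp z - 1)) := by
    filter_upwards [hF, self_mem_nhdsWithin] with z hz hz0
    rw [zero_add, dslope_of_ne _ hz0, slope_def_field, Complex.exp_zero, sub_zero, inv_div] at hz
    simp only [smul_eq_mul] at hz
    rw [hP, mul_div_right_comm]
    simpa only [PowerSeries.coeff_mk, mul_comm (_ ^ _)] using hz
  have hsE : ∀ z : ℂ, HasSum (fun n => PowerSeries.coeff n E * z ^ n) (Complex.exp z - 1) := by
    intro z
    have h1 := hasSum_exp_mul 1 z
    have h2 : HasSum (fun n => PowerSeries.coeff n (1 : PowerSeries ℂ) * z ^ n) 1 := by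
      convert! hasSum_single (f := fun n => PowerSeries.coeff n (1 : PowerSeries ℂ) * z ^ n) 0 ?_
        using 1
      · simp
      · intro n hn
        simp [PowerSeries.coeff_one, hn]
    rw [one_mul] at h1
    refine Eq.subst (motive := fun f => HasSum f _) (funext fun n => ?_) (h1.sub h2)
    rw [hE, map_sub, PowerSeries.coeff_exp]
    simp [sub_mul]
  have hsX : ∀ z : ℂ, HasSum (fun n => PowerSeries.coeff n
      (PowerSeries.X * PowerSeries.rescale a (PowerSeries.exp ℂ)) * z ^ n)
      (z * Complex.exp (a * z)) := by
    intro z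
    refine hasSum_coeff_mul ?_ ?_
    · convert! hasSum_single (f := fun n => PowerSeries.coeff n (PowerSeries.X : PowerSeries ℂ)
        * z ^ n) 1 ?_ using 1
      · simp
      · intro n hn
        simp [PowerSeries.coeff_X, hn]
    · refine Eq.subst (motive := fun f => HasSum f _) (funext fun n => ?_) (hasSum_exp_mul a z)
      rw [PowerSeries.coeff_rescale, PowerSeries.coeff_exp]
      simp [div_eq_mul_inv]
  have hPE : P * E = B * E := by
    rw [hBE]
    ext n
    refine congrFun (eq_of_frequently_hasSum (a := fun n => PowerSeries.coeff n (P * E))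
      (b := fun n => PowerSeries.coeff n (PowerSeries.X * PowerSeries.rescale a
        (PowerSeries.exp ℂ))) (Eventually.frequently ?_)) n
    filter_upwards [hsP, hne] with z hz hz0
    refine ⟨z * Complex.exp (a * z), ?_, hsX z⟩
    have h := hasSum_coeff_mul hz (hsE z)
    rwa [div_mul_cancel₀ _ hz0] at h
  have hE0 : E ≠ 0 := by
    intro h
    have h1 := congrArg (PowerSeries.coeff 1) h
    rw [hE, map_sub, PowerSeries.coeff_exp] at h1
    simp [PowerSeries.coeff_one] at h1
  have hPB : P = B := mul_right_cancel₀ hE0 hPE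
  filter_upwards [hsP] with z hz
  rw [hPB, hB] at hz
  refine Eq.subst (motive := fun f => HasSum f _) (funext fun n => ?_) hz
  rw [PowerSeries.coeff_mk, map_smul, Algebra.smul_def]
  simp [div_eq_inv_mul]

theorem hasSum_exp_neg_mul_natCast_add {w : ℂ} (hw : 0 < w.re) (a : ℝ) :
    HasSum (fun n : ℕ => Complex.exp (-w * ((n + a : ℝ) : ℂ)))
      (Complex.exp (-w * a) / (1 - Complex.exp (-w))) := by
  have h : ‖Complex.exp (-w)‖ < 1 := by
    rw [Complex.norm_exp, Real.exp_lt_one_iff]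
    simpa using hw
  refine Eq.subst (motive := fun f => HasSum f _) (funext fun n => ?_)
    ((hasSum_geometric_of_norm_lt_one h).mul_left (Complex.exp (-w * a)))
  rw [← Complex.exp_nat_mul, ← Complex.exp_add]
  congr 1
  push_cast
  ring

open Filter Topology in
/-- The exponential sum `∑ exp (-w (n + a))` expanded in powers of `w`: its regular part is the
generating function of the values of the Hurwitz zeta function at non-positive integers. -/
theorem eventually_hasSum_hurwitzZeta_neg {a : ℝ} (ha : 0 < a) (ha1 : a ≤ 1) :
    ∀ᶠ w in 𝓝[≠] (0 : ℂ), HasSum (fun n : ℕ => (-w) ^ n / (n.factorial : ℂ) *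
      HurwitzZeta.hurwitzZeta (a : UnitAddCircle) (-(n : ℂ)))
      (Complex.exp (-w * a) / (1 - Complex.exp (-w)) - 1 / w) := by
  have hlim : Tendsto (fun w : ℂ => -w) (𝓝[≠] 0) (𝓝[≠] 0) := by
    refine tendsto_nhdsWithin_of_tendsto_nhds_of_eventually_within _ ?_ ?_
    · have : ContinuousAt (fun z : ℂ => -z) 0 := by fun_prop
      simpa using this.tendsto.mono_left nhdsWithin_le_nhds
    · filter_upwards [self_mem_nhdsWithin] with z hz using neg_ne_zero.2 hz
  filter_upwards [hlim.eventually (eventually_hasSum_bernoulli a), self_mem_nhdsWithin]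
    with w hw (hw0 : w ≠ 0)
  have h1 := ((hasSum_nat_add_iff' 1).2 hw).mul_left (1 / w)
  have hval : 1 / w * (-w * Complex.exp (a * -w) / (Complex.exp (-w) - 1) -
      ∑ i ∈ Finset.range 1, Polynomial.aeval (a : ℂ) (Polynomial.bernoulli i) /
        (i.factorial : ℂ) * (-w) ^ i) =
      Complex.exp (-w * a) / (1 - Complex.exp (-w)) - 1 / w := by
    rw [Finset.sum_range_one, mul_comm (a : ℂ), ← neg_sub 1 (Complex.exp (-w)), neg_mul,
      neg_div_neg_eq]
    simp [Polynomial.bernoulli_zero]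
    field_simp
  rw [hval] at h1
  refine Eq.subst (motive := fun f => HasSum f _) (funext fun n => ?_) h1
  rw [hurwitzZeta_neg_natCast ha ha1, Nat.factorial_succ, pow_succ]
  have : (n.factorial : ℂ) ≠ 0 := by exact_mod_cast n.factorial_ne_zero
  have : (n : ℂ) + 1 ≠ 0 := by exact_mod_cast n.succ_ne_zero
  push_cast
  field_simp

theorem summable_lambertTerm_pow {a : ℝ} (ha : 0 < a) (n : ℕ) (κ : ℝ) {t : ℂ} (ht : 0 < t.re) :
    Summable (lambertTerm (fun x => (x : ℂ) ^ n) a κ t) := by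
  have hβ : 0 < π * t.re := by positivity
  refine summable_lambertTerm (B := n.factorial / (π * t.re) ^ n) ha hβ.le (by linarith)
    fun m => ?_
  have hx : 0 ≤ (m : ℝ) + a := by positivity
  have h := Real.pow_div_factorial_le_exp (π * t.re * (m + a)) (by positivity) n
  rw [norm_pow, Complex.norm_real, Real.norm_of_nonneg hx]
  rw [div_le_iff₀ (by positivity), mul_pow] at h
  rw [div_mul_eq_mul_div, le_div_iff₀ (by positivity)]
  linarith

/-- Expansion of an exponentially weighted Lambert series in powers of the exponent. -/
theorem hasSum_lambertSum_exp {a : ℝ} (ha : 0 < a) (κ : ℝ) {t w : ℂ} (hw : ‖w‖ < 2 * π * t.re) :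
    HasSum (fun n : ℕ => w ^ n / (n.factorial : ℂ) * lambertSum (fun x => (x : ℂ) ^ n) a κ t)
      (lambertSum (fun x => Complex.exp (w * x)) a κ t) := by
  set F : (ℕ × ℕ) × ℕ → ℂ := fun q =>
    (q.2.factorial : ℂ)⁻¹ * w ^ q.2 * lambertTerm (fun x => (x : ℂ) ^ q.2) a κ t q.1 with hF
  have hnorm : ∀ p : ℕ × ℕ, HasSum (fun n => ‖F (p, n)‖)
      (Real.exp (‖w‖ * (p.2 + a)) * Real.exp (-(2 * π * t.re * (p.1 + 1) * (p.2 + a)))) := by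
    intro p
    have h := (NormedSpace.expSeries_div_hasSum_exp (‖w‖ * (p.2 + a))).mul_right
      (Real.exp (-(2 * π * t.re * (p.1 + 1) * (p.2 + a))))
    rw [← Real.exp_eq_exp_ℝ] at h
    refine Eq.subst (motive := fun f => HasSum f _) (funext fun n => ?_) h
    have hx : 0 ≤ (p.2 : ℝ) + a := by positivity
    rw [hF, norm_mul, norm_lambertTerm, norm_mul, norm_inv, norm_pow, norm_pow, Complex.norm_real,
      Real.norm_of_nonneg hx, Complex.norm_natCast, mul_pow]
    ring
  have hs : Summable F := by
    refine Summable.of_norm ((summable_prod_of_nonneg fun q => norm_nonneg _).2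
      ⟨fun p => (hnorm p).summable, ?_⟩)
    simp only [(hnorm _).tsum_eq]
    exact summable_exp_lambert ha (norm_nonneg w) hw
  have hp : ∀ p : ℕ × ℕ, HasSum (fun n => F (p, n))
      (lambertTerm (fun x => Complex.exp (w * x)) a κ t p) := by
    intro p
    have h := (((hasSum_exp_mul w ((p.2 + a : ℝ) : ℂ)).mul_left
      (ee ((((p.1 : ℝ) + 1) * κ : ℝ) : ℂ))).mul_right
      (Complex.exp (-2 * (π : ℂ) * t * (((p.1 : ℝ) + 1 : ℝ) : ℂ) * (((p.2 : ℝ) + a : ℝ) : ℂ))))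
    refine Eq.subst (motive := fun f => HasSum f _) (funext fun n => ?_) h
    simp only [hF, lambertTerm]
    ring
  have htot : ∑' q, F q = lambertSum (fun x => Complex.exp (w * x)) a κ t :=
    (hs.hasSum.prod_fiberwise hp).tsum_eq.symm
  have hswap : HasSum (fun q : ℕ × (ℕ × ℕ) => F q.swap)
      (lambertSum (fun x => Complex.exp (w * x)) a κ t) := by
    rw [← htot]
    exact (Equiv.prodComm _ _).hasSum_iff.2 hs.hasSum
  have hfib := hswap.prod_fiberwise fun n => (hswap.summable.prod_factor n).hasSum
  refine Eq.subst (motive := fun f => HasSum f _) (funext fun n => ?_) hfib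
  simp only [Prod.swap, hF]
  rw [tsum_mul_left, lambertSum, div_eq_inv_mul]

theorem zetaScal_neg_natCast (n : ℕ) (γ κ : ℝ) {t : ℂ} (ht : 0 < t.re) :
    zetaScal (-(n : ℤ)) γ κ t = HurwitzZeta.hurwitzZeta (fracP γ : UnitAddCircle) (-(n : ℂ)) +
      lambertSum (fun x => (x : ℂ) ^ n) (fracP γ) κ t -
      (-1) ^ n * lambertSum (fun x => (x : ℂ) ^ n) (fracP (-γ)) (-κ) t := by
  have h : (fun x : ℝ => (x : ℂ) ^ (-(-(n : ℤ)))) = fun x : ℝ => (x : ℂ) ^ n := by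
    funext x
    rw [neg_neg, zpow_natCast]
  have hs : ∀ γ κ, Scal ((-(n : ℤ) : ℤ) : ℂ) 0 γ κ 0 t =
      lambertSum (fun x => (x : ℂ) ^ n) (fracP γ) κ t := fun γ κ => by
    rw [Scal_intCast, h]
    rw [h]
    exact summable_lambertTerm_pow (fracP_pos γ) n κ ht
  rw [zetaScal, hs, hs, coe_fracP, zpow_sub_one₀ (by norm_num), zpow_neg, zpow_natCast, ← inv_pow,
    inv_neg_one]
  push_cast
  ring

theorem norm_exp_mul_ofReal_le (w : ℂ) {x y : ℝ} (h : |x| ≤ y) :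
    ‖Complex.exp (w * x)‖ ≤ 1 * Real.exp (‖w‖ * y) := by
  rw [one_mul]
  refine (Complex.norm_exp_le_exp_norm _).trans (Real.exp_le_exp.2 ?_)
  rw [norm_mul, Complex.norm_real, Real.norm_eq_abs]
  gcongr

open Filter Topology in
/-- The lattice sum of `exp (-w x) / (e(itx + κ) - 1)` is, up to its polar part `-1/w`, the
exponential generating function of `zetaScal` at non-positive integers. -/
theorem eventually_hasSum_lattice_exp_mul_eeKer (γ κ : ℝ) {t : ℂ} (ht : 0 < t.re) :
    ∀ᶠ w in 𝓝[≠] (0 : ℂ), 0 < w.re → ∃ Y,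
      HasSum (fun n : ℕ => (-w) ^ n / (n.factorial : ℂ) * zetaScal (-(n : ℤ)) γ κ t) Y ∧
      HasSum (fun n : ℤ => if (n : ℝ) + γ = 0 then 0 else
        Complex.exp (-w * (((n : ℝ) + γ : ℝ) : ℂ)) *
          eeKer (I * t * (((n : ℝ) + γ : ℝ) : ℂ) + κ)) (-(1 / w) - Y) := by
  have hsmall : ∀ᶠ w in 𝓝[≠] (0 : ℂ), ‖w‖ < 2 * π * t.re :=
    (continuous_norm.continuousAt.eventually (gt_mem_nhds 
      (by simpa using mul_pos Real.two_pi_pos ht))).filter_mono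
      nhdsWithin_le_nhds
  filter_upwards [hsmall, eventually_hasSum_hurwitzZeta_neg (fracP_pos γ) (fracP_le_one γ)]
    with w hw hz hre
  have hpos : ∀ (n : ℕ) (γ : ℝ), |n + fracP γ| ≤ n + fracP γ := fun n γ =>
    (abs_of_nonneg (by have := fracP_pos γ; positivity)).le
  have h1 := hasSum_lambertSum_exp (fracP_pos γ) κ (w := -w) (by rwa [norm_neg])
  have h2 := hasSum_lambertSum_exp (fracP_pos (-γ)) (-κ) hw
  have h3 := hasSum_lattice_mul_eeKer (g := fun x => Complex.exp (-w * x)) (κ := κ) (B := 1) ht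
    (norm_nonneg (-w)) (by rwa [norm_neg])
    (fun n => norm_exp_mul_ofReal_le _ (hpos n γ))
    (fun n => norm_exp_mul_ofReal_le _ (by rw [abs_neg]; exact hpos n (-γ)))
    (hasSum_exp_neg_mul_natCast_add hre (fracP γ))
  simp only [Complex.ofReal_neg, neg_mul_neg] at h3
  refine ⟨_, Eq.subst (motive := fun f => HasSum f _) (funext fun n => ?_) ((hz.add h1).sub h2),
    Eq.subst (motive := fun S => HasSum _ S) ?_ h3⟩
  · rw [zetaScal_neg_natCast n γ κ ht, neg_pow w]
    linear_combination (w ^ n / n.factorial *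
      lambertSum (fun x => (x : ℂ) ^ n) (fracP (-γ)) (-κ) t) *
        (by rw [← mul_pow]; simp : (-1 : ℂ) ^ n * (-1) ^ n = 1)
  · ring

/-- The imaginary parts of `z` and `σ z` together control `z`. -/
theorem norm_le_mul_abs_im_add_abs_im {σ : ℂ} (hσ : 0 < σ.im) (z : ℂ) :
    ‖z‖ ≤ (1 + (1 + |σ.re|) / σ.im) * (|z.im| + |(σ * z).im|) := by
  have h1 : σ.im * |z.re| ≤ |(σ * z).im| + |σ.re| * |z.im| := by
    have h : σ.im * |z.re| = |(σ * z).im - σ.re * z.im| := by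
      rw [Complex.mul_im, add_sub_cancel_left, abs_mul, abs_of_pos hσ]
    rw [h, ← abs_mul]
    simpa only [Real.norm_eq_abs] using norm_sub_le (σ * z).im (σ.re * z.im)
  have h2 : |z.re| ≤ (1 + |σ.re|) / σ.im * (|z.im| + |(σ * z).im|) := by
    rw [div_mul_eq_mul_div, le_div_iff₀ hσ]
    nlinarith [abs_nonneg σ.re, abs_nonneg z.im, abs_nonneg (σ * z).im,
      mul_nonneg (abs_nonneg σ.re) (abs_nonneg (σ * z).im)]
  have h3 := Complex.norm_le_abs_re_add_abs_im z
  linarith [abs_nonneg (σ * z).im]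

theorem exp_neg_mul_div_max_le {ε : ℝ} (hε' : ε ≤ π) (z : ℂ) :
    Real.exp (-(ε * z.im)) / max 1 ‖ee z‖ ≤ Real.exp (-(ε * |z.im|)) := by
  have hm : Real.exp (ε * |z.im| - ε * z.im) ≤ max 1 ‖ee z‖ := by
    rcases le_total 0 z.im with h | h
    · rw [abs_of_nonneg h, sub_self, Real.exp_zero]
      exact le_max_left _ _
    · refine le_trans ?_ (le_max_right _ _)
      rw [norm_ee, abs_of_nonpos h, Real.exp_le_exp]
      nlinarith
  rw [div_le_iff₀ (by positivity)]
  refine le_trans (le_of_eq ?_) (mul_le_mul_of_nonneg_left hm (Real.exp_pos _).le)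
  rw [← Real.exp_add]
  ring_nf

open Filter Topology in
theorem tendsto_decay_exp {σ : ℂ} (hσ : 0 < σ.im) {ε : ℝ} (hε : 0 < ε) (hε' : ε ≤ π) :
    Tendsto (fun z : ℂ => ‖Complex.exp (I * ε * (1 + σ) * z)‖ * ‖z‖ /
      (max 1 ‖ee z‖ * max 1 ‖ee (σ * z)‖)) (Bornology.cobounded ℂ) (𝓝 0) := by
  set C := 1 + (1 + |σ.re|) / σ.im with hC
  have hC0 : 0 < C := by positivity
  have h0 : Tendsto (fun z : ℂ => ‖z‖ * Real.exp (-(ε / C * ‖z‖))) (Bornology.cobounded ℂ)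
      (𝓝 0) := by
    have h1 := (Real.tendsto_pow_mul_exp_neg_atTop_nhds_zero 1).comp
      ((tendsto_norm_cobounded_atTop (E := ℂ)).const_mul_atTop (div_pos hε hC0))
    have h2 := h1.const_mul (ε / C)⁻¹
    rw [mul_zero] at h2
    refine h2.congr fun z => ?_
    simp only [Function.comp, pow_one]
    rw [← mul_assoc, inv_mul_cancel_left₀ (div_pos hε hC0).ne']
  refine squeeze_zero (fun z => by positivity) (fun z => ?_) h0
  have hexp : ‖Complex.exp (I * ε * (1 + σ) * z)‖ =
      Real.exp (-(ε * z.im)) * Real.exp (-(ε * (σ * z).im)) := by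
    rw [Complex.norm_exp, ← Real.exp_add]
    congr 1
    simp
    ring
  have hle := norm_le_mul_abs_im_add_abs_im hσ z
  calc ‖Complex.exp (I * ε * (1 + σ) * z)‖ * ‖z‖ / (max 1 ‖ee z‖ * max 1 ‖ee (σ * z)‖)
      = ‖z‖ * ((Real.exp (-(ε * z.im)) / max 1 ‖ee z‖) *
        (Real.exp (-(ε * (σ * z).im)) / max 1 ‖ee (σ * z)‖)) := by rw [hexp]; ring
    _ ≤ ‖z‖ * (Real.exp (-(ε * |z.im|)) * Real.exp (-(ε * |(σ * z).im|))) := by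
        gcongr
        · exact exp_neg_mul_div_max_le hε' z
        · exact exp_neg_mul_div_max_le hε' (σ * z)
    _ ≤ _ := by
        rw [← Real.exp_add]
        refine mul_le_mul_of_nonneg_left (Real.exp_le_exp.2 ?_) (norm_nonneg _)
        rw [div_mul_eq_mul_div]
        have : ε * ‖z‖ / C ≤ ε * (|z.im| + |(σ * z).im|) := by
          rw [div_le_iff₀ hC0]
          nlinarith
        linarith

open Filter Topology in
/-- The transformation law of `zetaScal` at non-positive integers. -/
theorem zetaScal_sub_zetaScal_neg_natCast (n : ℕ) {μ ν : ℝ} {t : ℂ} (ht : 0 < t.re)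
    {a b : ℕ → ℂ}
    (ha : ∀ᶠ z in 𝓝[≠] (0 : ℂ), HasSum (fun j => a j * z ^ j) (z * eeKer (z + μ)))
    (hb : ∀ᶠ z in 𝓝[≠] (0 : ℂ), HasSum (fun j => b j * z ^ j) (z * eeKer (I * t * z + ν))) :
    zetaScal (-(n : ℤ)) (-μ) ν t -
        (-I * t) ^ (-(n : ℤ) - 1) * zetaScal (-(n : ℤ)) ν μ (1 / t) =
      2 * π * I * (if n = 0 then cauchyCoeff a b 1 else if n = 1 then cauchyCoeff a b 0 else 0) := by
  have ht0 : t ≠ 0 := fun h => by simp [h] at ht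
  have hσ : 0 < (I * t).im := by simpa using ht
  have hσ0 : I * t ≠ 0 := mul_ne_zero I_ne_zero ht0
  have ht1 : 0 < (1 / t).re := by
    rw [one_div, Complex.inv_re]
    exact div_pos ht (Complex.normSq_pos.2 ht0)
  set c : ℂ := I * (1 / t) with hc
  have hc0 : c ≠ 0 := mul_ne_zero I_ne_zero (one_div_ne_zero ht0)
  have hcσ : c * (I * t) = -1 := by rw [hc]; field_simp; exact I_sq
  set h := cauchyCoeff a b with hh
  set Z₁ : ℕ → ℂ := fun n => zetaScal (-(n : ℤ)) (-μ) ν t with hZ₁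
  set Z₂ : ℕ → ℂ := fun n => zetaScal (-(n : ℤ)) ν μ (1 / t) with hZ₂
  have htI : t - I ≠ 0 := fun h0 => by
    rw [sub_eq_zero] at h0
    simp [h0] at ht
  have hray : Tendsto (fun ε : ℝ => (ε : ℂ) * (t - I)) (𝓝[>] 0) (𝓝[≠] 0) := by
    refine tendsto_nhdsWithin_of_tendsto_nhds_of_eventually_within _ ?_ ?_
    · have : ContinuousAt (fun ε : ℝ => (ε : ℂ) * (t - I)) 0 := by fun_prop
      simpa using this.tendsto.mono_left nhdsWithin_le_nhds
    · filter_upwards [self_mem_nhdsWithin] with ε (hε : 0 < ε)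
      exact mul_ne_zero (by exact_mod_cast hε.ne') htI
  have hmulc : Tendsto (fun w : ℂ => w * c) (𝓝[≠] 0) (𝓝[≠] 0) := by
    refine tendsto_nhdsWithin_of_tendsto_nhds_of_eventually_within _ ?_ ?_
    · have : ContinuousAt (fun w : ℂ => w * c) 0 := by fun_prop
      simpa using this.tendsto.mono_left nhdsWithin_le_nhds
    · filter_upwards [self_mem_nhdsWithin] with w hw using mul_ne_zero hw hc0
  have hev : ∀ᶠ ε : ℝ in 𝓝[>] 0,
      HasSum (fun n => ((-1) ^ n / (n.factorial : ℂ) * (Z₁ n + (I * t)⁻¹ * c ^ n * Z₂ n)) *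
        ((ε : ℂ) * (t - I)) ^ n) (2 * π * I * (h 1 - (ε : ℂ) * (t - I) * h 0)) := by
    filter_upwards [self_mem_nhdsWithin, Ioo_mem_nhdsGT Real.pi_pos,
      hray.eventually (eventually_hasSum_lattice_exp_mul_eeKer (-μ) ν ht),
      (hmulc.comp hray).eventually (eventually_hasSum_lattice_exp_mul_eeKer ν μ ht1)]
      with ε (hε : 0 < ε) hεπ h1 h2
    simp only [Function.comp] at h2
    set w : ℂ := (ε : ℂ) * (t - I) with hw
    have hw0 : w ≠ 0 := mul_ne_zero (by exact_mod_cast hε.ne') htI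
    have hwre : 0 < w.re := by
      rw [hw, Complex.re_ofReal_mul]
      simpa using mul_pos hε ht
    have hwc : w * c = (ε : ℂ) * (I + 1 / t) := by
      rw [hw, hc]
      field_simp
      linear_combination (-(ε : ℂ)) * I_sq
    have hwcre : 0 < (w * c).re := by
      rw [hwc, Complex.re_ofReal_mul, Complex.add_re, Complex.I_re, zero_add]
      exact mul_pos hε ht1
    obtain ⟨Y₁, hY₁, hS₁⟩ := h1 hwre
    obtain ⟨Y₂, hY₂, hS₂⟩ := h2 hwcre
    have hS₂' : HasSum (fun n : ℤ => if (n : ℝ) + ν = 0 then 0 else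
        Complex.exp (-w * (-(((n : ℝ) + ν : ℝ) : ℂ) / (I * t))) *
          eeKer (-(((n : ℝ) + ν : ℝ) : ℂ) / (I * t) + μ)) (-(1 / (w * c)) - Y₂) := by
      simp only [neg_ofReal_div_I_mul, ← mul_assoc, neg_mul] at hS₂ ⊢
      simpa only [hc, ← mul_assoc] using hS₂
    have hres := sum_residues_eq_zero hσ (g := fun z => Complex.exp (-w * z)) (M := 2)
      (d := cauchyCoeff (fun i => (-w) ^ i / (i.factorial : ℂ)) h) (fun z _ => by fun_prop)
      (by norm_num) ?_ ?_ hS₁ hS₂'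
    · have hd : cauchyCoeff (fun i => (-w) ^ i / (i.factorial : ℂ)) h (2 - 1) = h 1 - w * h 0 := by
        rw [cauchyCoeff_one]
        simp
        ring
      rw [hd] at hres
      have hcancel : 1 / w + (I * t)⁻¹ * (1 / (w * c)) = 0 := by
        field_simp
        linear_combination hcσ
      have hval : Y₁ + (I * t)⁻¹ * Y₂ = 2 * π * I * (h 1 - w * h 0) := by
        linear_combination (-1) * hres - hcancel
      rw [← hval]
      refine Eq.subst (motive := fun f => HasSum f _) (funext fun n => ?_)
        (hY₁.add (hY₂.mul_left (I * t)⁻¹))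
      rw [neg_pow w, neg_pow (w * c), mul_pow w]
      ring
    · filter_upwards [ha, hb, self_mem_nhdsWithin] with z hza hzb (hz : z ≠ 0)
      have h4 := hasSum_cauchyCoeff (hasSum_exp_mul (-w) z) (hasSum_cauchyCoeff hza hzb)
      refine Eq.subst (motive := fun S => HasSum _ S) ?_ h4
      ring
    · refine (tendsto_decay_exp hσ hε hεπ.2.le).congr fun z => ?_
      congr 4
      rw [hw]
      linear_combination (ε * t * z) * I_sq
  have hcoeff := eq_of_frequently_hasSum
    (a := fun n => (-1) ^ n / (n.factorial : ℂ) * (Z₁ n + (I * t)⁻¹ * c ^ n * Z₂ n))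
    (b := fun n => if n = 0 then 2 * π * I * h 1 else if n = 1 then -(2 * π * I * h 0) else 0)
    (hray.frequently (Eventually.frequently (hev.mono fun ε hε => ⟨_, hε, ?_⟩)))
  · have h5 := congrFun hcoeff n
    have h6 : (-I * t) ^ (-(n : ℤ) - 1) = -((I * t)⁻¹ * c ^ n) := by
      have h7 : -I * t = c⁻¹ := by
        exact eq_inv_of_mul_eq_one_left (by linear_combination -hcσ)
      have h8 : (I * t)⁻¹ = -c := by
        rw [inv_eq_iff_eq_inv, eq_comm, inv_eq_iff_eq_inv, eq_comm]
        exact inv_eq_of_mul_eq_one_left (by linear_combination -hcσ)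
      rw [h7, h8, inv_zpow, ← zpow_neg, neg_sub, sub_neg_eq_add, ← Nat.cast_one (R := ℤ),
        ← Nat.cast_add, zpow_natCast, pow_add, pow_one]
      ring
    rw [h6]
    have h9 : Z₁ n + (I * t)⁻¹ * c ^ n * Z₂ n = (-1) ^ n * (n.factorial : ℂ) *
        ((-1) ^ n / (n.factorial : ℂ) * (Z₁ n + (I * t)⁻¹ * c ^ n * Z₂ n)) := by
      have hf : (n.factorial : ℂ) ≠ 0 := by exact_mod_cast n.factorial_ne_zero
      have hs : (-1 : ℂ) ^ n * (-1) ^ n = 1 := by rw [← mul_pow]; simp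
      field_simp
      rw [← pow_mul, mul_comm n 2, pow_mul]
      simp
    rw [h5] at h9
    change Z₁ n - -((I * t)⁻¹ * c ^ n) * Z₂ n = _
    rw [neg_mul, sub_neg_eq_add, h9]
    split_ifs with h10 h11
    · simp [h10]
    · simp [h11]
    · simp
  · have h5 := hasSum_sum_of_ne_finset_zero (L := .unconditional ℕ) (s := Finset.range 2)
      (f := fun n : ℕ => (if n = 0 then 2 * π * I * h 1 else if n = 1 then -(2 * π * I * h 0) else 0)
        * ((ε : ℂ) * (t - I)) ^ n) (fun n hn => by
          rw [Finset.mem_range] at hn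
          rw [if_neg (by omega), if_neg (by omega), zero_mul])
    refine Eq.subst (motive := fun S => HasSum _ S) ?_ h5
    simp [Finset.sum_range_succ]
    ring

/-- The Cauchy product of the Laurent coefficients of the two kernels, expressed through the
Taylor coefficients `A_j` and `B_j`. -/
theorem two_pi_I_mul_cauchyCoeff (a b : ℕ → ℂ) {τ : ℂ} (hτ : τ ≠ 0) (n : ℕ) :
    2 * π * I * cauchyCoeff
        (fun j => a j * (2 * π * I * 1) ^ ((j : ℤ) - 1) / (Nat.factorial j : ℂ))
        (fun j => b j * (2 * π * I * (I * τ)) ^ ((j : ℤ) - 1) / (Nat.factorial j : ℂ)) n =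
      (-2 * (π : ℂ)) ^ ((n : ℤ) - 1) * ∑ j ∈ Finset.range (n + 1),
        (-I) ^ j * a j * b (n - j) / ((Nat.factorial j : ℂ) * (Nat.factorial (n - j) : ℂ)) *
          τ ^ ((n : ℤ) - 1 - (j : ℤ)) := by
  have hπ : (π : ℂ) ≠ 0 := by exact_mod_cast Real.pi_ne_zero
  have h2 : (-2 * (π : ℂ)) ≠ 0 := mul_ne_zero (by norm_num) hπ
  have hc : 2 * (π : ℂ) * I = (-2 * π) * (-I) := by ring
  have hd : 2 * (π : ℂ) * I * (I * τ) = (-2 * π) * τ := by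
    linear_combination (2 * π * τ) * I_sq
  have hI : -I ≠ 0 := neg_ne_zero.2 I_ne_zero
  rw [cauchyCoeff, Finset.Nat.sum_antidiagonal_eq_sum_range_succ_mk, Finset.mul_sum,
    Finset.mul_sum]
  refine Finset.sum_congr rfl fun j hj => ?_
  have hjn : j ≤ n := Nat.lt_succ_iff.1 (Finset.mem_range.1 hj)
  rw [mul_one, hd, hc]
  have key : (-2 * (π : ℂ)) * (-I) * (((-2 * π) * (-I)) ^ ((j : ℤ) - 1) *
      ((-2 * π) * τ) ^ (((n - j : ℕ) : ℤ) - 1)) =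
      (-2 * (π : ℂ)) ^ ((n : ℤ) - 1) * ((-I) ^ j * τ ^ ((n : ℤ) - 1 - (j : ℤ))) := by
    rw [mul_zpow _ τ, ← mul_assoc ((-2 * (π : ℂ)) * (-I)), ← zpow_one_add₀ (mul_ne_zero h2 hI),
      add_sub_cancel, zpow_natCast, mul_pow, Nat.cast_sub hjn]
    rw [show (n : ℤ) - j - 1 = (n - 1) - j by ring, zpow_sub₀ h2, zpow_natCast]
    field_simp
  linear_combination (a j * b (n - j) / (Nat.factorial j * Nat.factorial (n - j))) * key

/-- Corollary 4.2 of the paper: the pairing of `ζ(k,-μ)` and `ζ(k,ν)`.  The family `A`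
is the family of coefficients `A_j(Y)` from `Z/(Y e^Z - 1) = Σ_j A_j(Y) Z^j/j!`. -/
theorem statement5 (μ ν : ℝ) (k : ℤ) (hk : k ≠ 1) (τ : ℂ) (hτ : 0 < τ.re)
    (A : ℕ → ℂ → ℂ)
    (hA : ∀ Y : ℂ, ∀ᶠ Z in nhdsWithin (0 : ℂ) {(0 : ℂ)}ᶜ,
      HasSum (fun j : ℕ => A j Y * Z ^ j / (Nat.factorial j : ℂ))
        (Z / (Y * Complex.exp Z - 1))) :
    HurwitzZeta.hurwitzZeta ((-μ : ℝ) : UnitAddCircle) ((k : ℤ) : ℂ) +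
          Scal (k : ℂ) 0 (-μ) ν 0 τ +
          (-1 : ℂ) ^ (k - 1) * Scal (k : ℂ) 0 μ (-ν) 0 τ -
        (-2 * (Real.pi : ℂ)) ^ k *
          ∑ j ∈ Finset.range (k + 2).toNat,
            (-Complex.I) ^ j * A j (ee ((μ : ℝ) : ℂ)) * A ((k + 1).toNat - j) (ee ((ν : ℝ) : ℂ)) /
                ((Nat.factorial j : ℂ) * (Nat.factorial ((k + 1).toNat - j) : ℂ)) *
              τ ^ (k - (j : ℤ)) =
      (-Complex.I * τ) ^ (k - 1) *
        (HurwitzZeta.hurwitzZeta ((ν : ℝ) : UnitAddCircle) ((k : ℤ) : ℂ) +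
          Scal (k : ℂ) 0 ν μ 0 (1 / τ) +
          (-1 : ℂ) ^ (k - 1) * Scal (k : ℂ) 0 (-ν) (-μ) 0 (1 / τ)) := by
  have hτ0 : τ ≠ 0 := fun h => by simp [h] at hτ
  have ha := eventually_hasSum_mul_eeKer one_ne_zero (hA (ee μ))
  have hb := eventually_hasSum_mul_eeKer (mul_ne_zero I_ne_zero hτ0) (hA (ee ν))
  simp only [one_mul] at ha
  have hzeta : HurwitzZeta.hurwitzZeta ((-μ : ℝ) : UnitAddCircle) ((k : ℤ) : ℂ) +
      Scal (k : ℂ) 0 (-μ) ν 0 τ + (-1 : ℂ) ^ (k - 1) * Scal (k : ℂ) 0 μ (-ν) 0 τ =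
      zetaScal k (-μ) ν τ := by rw [zetaScal, neg_neg]
  rw [hzeta]
  change _ = (-I * τ) ^ (k - 1) * zetaScal k ν μ (1 / τ)
  have hsum (N : ℕ) (hN : (N : ℤ) = k + 1) :
      (-2 * (π : ℂ)) ^ k * ∑ j ∈ Finset.range (k + 2).toNat,
        (-I) ^ j * A j (ee μ) * A ((k + 1).toNat - j) (ee ν) /
          ((Nat.factorial j : ℂ) * (Nat.factorial ((k + 1).toNat - j) : ℂ)) * τ ^ (k - (j : ℤ)) =
      2 * π * I * cauchyCoeff
        (fun j => A j (ee μ) * (2 * π * I * 1) ^ ((j : ℤ) - 1) / (Nat.factorial j : ℂ))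
        (fun j => A j (ee ν) * (2 * π * I * (I * τ)) ^ ((j : ℤ) - 1) / (Nat.factorial j : ℂ))
        N := by
    have h := two_pi_I_mul_cauchyCoeff (fun j => A j (ee μ)) (fun j => A j (ee ν)) hτ0 N
    rw [show (k + 2).toNat = N + 1 by omega, show (k + 1).toNat = N by omega]
    rw [show (N : ℤ) - 1 = k by omega] at h
    exact h.symm
  rcases le_or_gt 2 k with h2 | h2
  · obtain ⟨K, rfl⟩ := Int.eq_ofNat_of_zero_le (by omega : 0 ≤ k)
    rw [hsum (K + 1) (by push_cast; ring)]
    linear_combination zetaScal_sub_zetaScal_of_two_le (by omega : 2 ≤ K) hτ ha hb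
  · obtain ⟨n, rfl⟩ : ∃ n : ℕ, k = -(n : ℤ) := ⟨(-k).toNat, by omega⟩
    have h := zetaScal_sub_zetaScal_neg_natCast n hτ ha hb
    split_ifs at h with h0 h1
    · rw [hsum 1 (by simp [h0])]
      linear_combination h
    · rw [hsum 0 (by simp [h1])]
      linear_combination h
    · rw [show (-(n : ℤ) + 2).toNat = 0 by omega, Finset.range_zero, Finset.sum_empty]
      linear_combination h

end
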